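/- Let g ≥ 0, n ≥ 1, a, b ∈ ℤ, and let k be an integer with k ≥ 2g−3+a+b. Then [L_g^{a,b}(y,x_1,…,x_n)]_{y^k} = 0; that is, for all integers d_1,…,d_n ≥ 0 the coefficient of y^k Π_j x_j^{d_j} in L_g^{a,b}(y,x_1,…,x_n) vanishes. -/

import Mathlib

open MvPolynomial Finset

noncomputable section

/-- The polynomial ring `ℚ[x_1,…,x_n]`. -/
abbrev R (n : ℕ) : Type := MvPolynomial (Fin n) ℚ

/-- The field of rational functions `ℚ(x_1,…,x_n)`. -/
abbrev K (n : ℕ) : Type := FractionRing (R n)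

/-- `x_1 + ⋯ + x_n` as an element of `K n`. -/
def SX (n : ℕ) : K n := algebraMap (R n) (K n) (∑ j, X j)

/-- `x_1^3 + ⋯ + x_n^3` as an element of `K n`. -/
def SX3 (n : ℕ) : K n := algebraMap (R n) (K n) (∑ j, (X j)^3)

/-- `Δ(x_1,…,x_n) = ((Σ x_j)^3 − Σ x_j^3)/3`. -/
def Dlt (n : ℕ) : K n := ((SX n)^3 - SX3 n) / 3

/-- The ring homomorphism `ℚ[x_1,…,x_{|I|}] → ℚ(x_1,…,x_n)` substituting the variables
of the subset `I` (in increasing order). -/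
def embRH {n : ℕ} (I : Finset (Fin n)) : R I.card →+* K n :=
  (algebraMap (R n) (K n)).comp
    (MvPolynomial.rename (fun i : Fin I.card => ((I.orderIsoOfFin rfl) i : Fin n))).toRingHom

lemma embRH_inj {n : ℕ} (I : Finset (Fin n)) : Function.Injective (embRH I) := by
  have h1 : Function.Injective (fun i : Fin I.card => ((I.orderIsoOfFin rfl) i : Fin n)) := by
    intro i j hij
    exact (I.orderIsoOfFin rfl).injective (Subtype.val_injective hij)
  have h2 := (IsFractionRing.injective (R n) (K n)).comp (MvPolynomial.rename_injective _ h1)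
  simpa [embRH, RingHom.coe_comp] using h2

/-- The field embedding `ℚ(x_1,…,x_{|I|}) → ℚ(x_1,…,x_n)` substituting the variables
of the subset `I` (in increasing order).  Used for expressions like `G_{r'}(x_I)`. -/
def emb {n : ℕ} (I : Finset (Fin n)) : K I.card →+* K n :=
  IsFractionRing.lift (embRH_inj I)

/-- The normalized `n`-point functions `G_g(x_1,…,x_n)`, defined with a fuel parameter
(first argument) for structural recursion; for `fuel ≥ n` this computes the recursively
defined normalized `n`-point function:  `G_0(x) = x^{-2}`, `G_g(x) = 0` for `g ≥ 1`, and
for `n ≥ 2`,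
`G_g = Σ_{r+s=g} ((2r+n−3)!!/(4^s(2r+2s+n−1)!!)) P_r Δ^s` where
`P_r = (1/(2Σx_j)) Σ_{I⊔J={1..n}, I,J≠∅} (Σ_I x)²(Σ_J x)² Σ_{r'≤r} G_{r'}(x_I)G_{r−r'}(x_J)`. -/
def Gf : (fuel : ℕ) → (n : ℕ) → ℕ → K n
  | _, 0, _ => 0
  | _, 1, 0 => (algebraMap (R 1) (K 1) (X 0)) ^ (-2 : ℤ)
  | _, 1, _+1 => 0
  | 0, _+2, _ => 0
  | fuel+1, n+2, g =>
      ∑ s ∈ Finset.range (g+1),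
        (((Nat.doubleFactorial (2*(g-s)+(n+2)-3) : ℚ) /
          (4^s * (Nat.doubleFactorial (2*g+(n+2)-1) : ℚ))) : K (n+2)) *
        ((2 * SX (n+2))⁻¹ *
          ∑ I : Finset (Fin (n+2)),
            if I ≠ ∅ ∧ I ≠ univ then
              (algebraMap (R (n+2)) (K (n+2)) (∑ i ∈ I, X i))^2 *
              (algebraMap (R (n+2)) (K (n+2)) (∑ i ∈ Iᶜ, X i))^2 *
              ∑ r' ∈ Finset.range ((g-s)+1),
                emb I (Gf fuel I.card r') * emb Iᶜ (Gf fuel Iᶜ.card ((g-s) - r'))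
            else 0) *
        (Dlt (n+2))^s

/-- The normalized `n`-point function `G_g(x_1,…,x_n)` as an element of `ℚ(x_1,…,x_n)`. -/
def Gnpt (n g : ℕ) : K n := Gf n n g

/-- `P_r(x_1,…,x_n)`. -/
def Ppoly (n r : ℕ) : K n :=
  (2 * SX n)⁻¹ *
    ∑ I : Finset (Fin n),
      if I ≠ ∅ ∧ I ≠ univ then
        (algebraMap (R n) (K n) (∑ i ∈ I, X i))^2 *
        (algebraMap (R n) (K n) (∑ i ∈ Iᶜ, X i))^2 *
        ∑ r' ∈ Finset.range (r+1), emb I (Gnpt I.card r') * emb Iᶜ (Gnpt Iᶜ.card (r - r'))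
      else 0

/-- The `n`-point function `F_g(x_1,…,x_n) = Σ_{h+d=g} (1/d!)((Σx_j^3)/24)^d G_h(x_1,…,x_n)`. -/
def Fnpt (n g : ℕ) : K n :=
  ∑ d ∈ Finset.range (g+1),
    ((1 / (Nat.factorial d : ℚ)) : K n) * (SX3 n / 24)^d * Gnpt n (g-d)

open Classical in
/-- The coefficient of the monomial `Π x_j^{d_j}` of an element of `ℚ(x_1,…,x_n)` which is
a polynomial (junk value `0` otherwise). -/
def coeffK {n : ℕ} (f : K n) (d : Fin n → ℕ) : ℚ :=
  if h : ∃ p : R n, algebraMap (R n) (K n) p = f then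
    MvPolynomial.coeff (Finsupp.equivFunOnFinite.symm d) h.choose
  else 0

/-- The intersection index `⟨τ_{d_1} ⋯ τ_{d_n}⟩_g`, i.e. the coefficient of `Π x_j^{d_j}`
in `F_g(x_1,…,x_n)`.  For `(g,n) = (0,1), (0,2)` and nonnegative `d_j` the value is `0`
(the conventional values `⟨τ_{-2}⟩_0 = 1`, `⟨τ_k τ_{-1-k}⟩_0 = (-1)^k` have a negative index). -/
def bracket (g : ℕ) {n : ℕ} (d : Fin n → ℕ) : ℚ :=
  if g = 0 ∧ n ≤ 2 then 0 else coeffK (Fnpt n g) d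

/-- `⟨τ_j Π_{i ∈ I} τ_{d_i}⟩_g` for a subset `I ⊆ {1,…,n}`. -/
def bracketI (g : ℕ) {n : ℕ} (j : ℕ) (I : Finset (Fin n)) (d : Fin n → ℕ) : ℚ :=
  bracket g (Fin.cons j (fun i : Fin I.card => d ((I.orderIsoOfFin rfl) i)))


/-! ### Laurent expansions in `y` (formal series in `ℚ[x_1,…,x_n][[y,y⁻¹]]` of bounded
`y`-degree, realized as Hahn/Laurent series in the variable `t = y⁻¹`, so that the
coefficient of `y^k` is the Hahn coefficient at `-k`). -/

/-- Laurent series in `t = y⁻¹` with coefficients in `ℚ[x_1,…,x_n]`. -/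
abbrev Lau (n : ℕ) : Type := LaurentSeries (R n)

/-- The generalized binomial coefficient `C(p,k) = p(p−1)⋯(p−k+1)/k!` for `p : ℤ`, `k : ℕ`. -/
def binomZ (p : ℤ) (k : ℕ) : ℚ := (∏ i ∈ Finset.range k, ((p : ℚ) - i)) / (Nat.factorial k)

/-- The expansion of `(y + c)^m = Σ_{k≥0} C(m,k) c^k y^{m−k}` as a Laurent series
in `t = y⁻¹` (for `m ≥ 0` this is the usual binomial expansion of the polynomial). -/
def yExpAdd {n : ℕ} (c : R n) (m : ℤ) : Lau n :=
  (HahnSeries.single (-m) (1 : R n)) *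
    HahnSeries.ofPowerSeries ℤ (R n)
      (PowerSeries.mk fun k => MvPolynomial.C (binomZ m k) * c^k)

/-- The expansion of `(±y + c)^m`, where the sign is `+` if `σ = true` and `−` otherwise;
it is computed as `(±1)^m (y ± c)^m`. -/
def LExp {n : ℕ} (σ : Bool) (c : R n) (m : ℤ) : Lau n :=
  (if σ then 1 else if Even m then 1 else -1 : Lau n) *
    yExpAdd ((if σ then 1 else -1 : R n) * c) m

open Classical in
/-- The polynomial representing an element of `ℚ(x_1,…,x_n)` lying in `ℚ[x_1,…,x_n]`
(junk value `0` otherwise). -/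
def polyOf {n : ℕ} (f : K n) : R n :=
  if h : ∃ p : R n, algebraMap (R n) (K n) p = f then h.choose else 0

/-- `±y` as a Laurent series in `t = y⁻¹`. -/
def yLau (n : ℕ) (σ : Bool) : Lau n :=
  (if σ then 1 else -1 : Lau n) * HahnSeries.single (-1 : ℤ) (1 : R n)

/-- The expansion of `F_g(±y, x_I)` as a Laurent series in `t = y⁻¹` with coefficients in
`ℚ[x_1,…,x_n]`: for `(g,|I|+1) = (0,1)` it is `(±y)^{-2} = y^{-2}`, for `(g,|I|+1) = (0,2)`
it is `1/(±y + x_i) = Σ_{k≥0} (−1)^k x_i^k (±y)^{−k−1}`, and otherwise it is obtained by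
substituting `±y` and the variables of `I` into the polynomial `F_g`. -/
def FExp {n : ℕ} (σ : Bool) (g : ℕ) (I : Finset (Fin n)) : Lau n :=
  if g = 0 ∧ I.card = 0 then HahnSeries.single (2 : ℤ) (1 : R n)
  else if g = 0 ∧ I.card = 1 then LExp σ (∑ i ∈ I, X i) (-1)
  else
    MvPolynomial.eval₂ ((HahnSeries.C).comp (algebraMap ℚ (R n)))
      (Fin.cons (yLau n σ)
        (fun i : Fin I.card => HahnSeries.C (X ((I.orderIsoOfFin rfl) i : Fin n))))
      (polyOf (Fnpt (I.card + 1) g))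

/-- `L_g^{a,b}(y, x_1,…,x_n) = Σ_{g'=0}^{g} Σ_{I⊔J={1,…,n}} (y+Σ_I x)^a (−y+Σ_J x)^b
F_{g'}(y,x_I) F_{g−g'}(−y,x_J)` as a Laurent series in `t = y⁻¹`. -/
def LL (g n : ℕ) (a b : ℤ) : Lau n :=
  ∑ gp ∈ Finset.range (g+1), ∑ I : Finset (Fin n),
    LExp true (∑ i ∈ I, X i) a * LExp false (∑ i ∈ Iᶜ, X i) b *
      FExp true gp I * FExp false (g - gp) Iᶜ

/-- The coefficient of `y^k Π_j x_j^{d_j}` in a Laurent series in `t = y⁻¹` with coefficients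
in `ℚ[x_1,…,x_n]`. -/
def coeffL {n : ℕ} (f : Lau n) (k : ℤ) (d : Fin n → ℕ) : ℚ :=
  MvPolynomial.coeff (Finsupp.equivFunOnFinite.symm d) (f.coeff (-k))

/-- The index of the variable `z_i` among the `a + b + n` variables `z, w, x`. -/
def zIdx (a b n : ℕ) (i : Fin a) : Fin (a+b+n) := ⟨i.1, by have := i.2; omega⟩

/-- The index of the variable `w_i` among the `a + b + n` variables `z, w, x`. -/
def wIdx (a b n : ℕ) (i : Fin b) : Fin (a+b+n) := ⟨a + i.1, by have := i.2; omega⟩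

/-- The index of the variable `x_i` among the `a + b + n` variables `z, w, x`. -/
def xIdx (a b n : ℕ) (i : Fin n) : Fin (a+b+n) := ⟨a + b + i.1, by have := i.2; omega⟩

/-- `L_g(y; z_1,…,z_a; w_1,…,w_b; x_1,…,x_n)
 = Σ_{g'=0}^{g} Σ_{I⊔J={1,…,n}} F_{g'}(y, z, x_I) F_{g−g'}(−y, w, x_J)`,
as a Laurent series in `t = y⁻¹` with coefficients in `ℚ[z,w,x]`. -/
def LLm (g n a b : ℕ) : Lau (a+b+n) :=
  ∑ gp ∈ Finset.range (g+1), ∑ I : Finset (Fin n),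
    FExp true gp ((univ.image (zIdx a b n)) ∪ I.image (xIdx a b n)) *
    FExp false (g - gp) ((univ.image (wIdx a b n)) ∪ Iᶜ.image (xIdx a b n))

/-- The exponent vector of the monomial `Π z_j^{r_j} Π w_j^{s_j} Π x_j^{d_j}`. -/
def expVec (a b n : ℕ) (r : Fin a → ℕ) (s : Fin b → ℕ) (d : Fin n → ℕ) :
    Fin (a+b+n) → ℕ :=
  fun v =>
    if h : v.1 < a then r ⟨v.1, h⟩
    else if h2 : v.1 < a + b then s ⟨v.1 - a, by omega⟩
    else d ⟨v.1 - (a+b), by have := v.2; omega⟩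


/-! ### Sums over ordered set partitions -/

section SubsetConvolution

variable {ι : Type*} [DecidableEq ι] {A : Type*}

lemma sum_powerset_sdiff [AddCommMonoid A] (f : Finset ι → Finset ι → A) (U : Finset ι) :
    ∑ I ∈ U.powerset, f I (U \ I) = ∑ I ∈ U.powerset, f (U \ I) I := by
  refine Finset.sum_nbij' (fun I => U \ I) (fun I => U \ I) ?_ ?_ ?_ ?_ ?_
  · simp
  · simp
  · intro I hI
    simpa using hI
  · intro I hI
    simpa using hI
  · intro I hI
    rw [Finset.sdiff_sdiff_eq_self (by simpa using hI)]

lemma sum_powerset_powerset_sdiff [AddCommMonoid A]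
    (f : Finset ι → Finset ι → Finset ι → A) (U : Finset ι) :
    ∑ I ∈ U.powerset, ∑ J ∈ (U \ I).powerset, f I J ((U \ I) \ J) =
      ∑ J ∈ U.powerset, ∑ I ∈ (U \ J).powerset, f I J ((U \ J) \ I) := by
  rw [Finset.sum_sigma', Finset.sum_sigma']
  refine Finset.sum_nbij' (fun p => ⟨p.2, p.1⟩) (fun p => ⟨p.2, p.1⟩) ?_ ?_ ?_ ?_ ?_
  · rintro ⟨I, J⟩ h
    simp only [mem_sigma, mem_powerset, subset_sdiff] at h ⊢
    exact ⟨h.2.1, h.1, h.2.2.symm⟩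
  · rintro ⟨I, J⟩ h
    simp only [mem_sigma, mem_powerset, subset_sdiff] at h ⊢
    exact ⟨h.2.1, h.1, h.2.2.symm⟩
  · simp
  · simp
  · rintro ⟨I, J⟩ -
    simp only [sdiff_sdiff_left, sup_eq_union, union_comm]

lemma sum_powerset_powerset [AddCommMonoid A]
    (f : Finset ι → Finset ι → Finset ι → A) (U : Finset ι) :
    ∑ I ∈ U.powerset, ∑ J ∈ I.powerset, f J (I \ J) (U \ I) =
      ∑ J ∈ U.powerset, ∑ I ∈ (U \ J).powerset, f I J ((U \ J) \ I) := by
  rw [← sum_powerset_powerset_sdiff, Finset.sum_sigma', Finset.sum_sigma']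
  refine Finset.sum_nbij' (fun p => ⟨p.2, p.1 \ p.2⟩) (fun p => ⟨p.1 ∪ p.2, p.1⟩) ?_ ?_ ?_ ?_ ?_
  · rintro ⟨I, J⟩ h
    simp only [mem_sigma, mem_powerset, subset_sdiff] at h ⊢
    exact ⟨h.2.trans h.1, sdiff_subset.trans h.1, sdiff_disjoint⟩
  · rintro ⟨I, J⟩ h
    simp only [mem_sigma, mem_powerset, subset_sdiff] at h ⊢
    exact ⟨union_subset h.1 h.2.1, subset_union_left⟩
  · rintro ⟨I, J⟩ h
    simp only [mem_sigma, mem_powerset] at h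
    simp [h.2]
  · rintro ⟨I, J⟩ h
    simp only [mem_sigma, mem_powerset, subset_sdiff] at h
    simp [h.2.2.sdiff_eq_left, union_sdiff_left]
  · rintro ⟨I, J⟩ h
    simp only [mem_sigma, mem_powerset] at h
    simp only [sdiff_sdiff_left, sup_eq_union, union_sdiff_of_subset h.2]

lemma sum_powerset_map {κ : Type*} [AddCommMonoid A] (e : κ ↪ ι) (I : Finset κ)
    (f : Finset ι → A) :
    ∑ J ∈ (I.map e).powerset, f J = ∑ J ∈ I.powerset, f (J.map e) := by
  classical
  rw [Finset.map_eq_image, Finset.powerset_image, Finset.sum_image]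
  · simp [Finset.map_eq_image]
  · intro J _ J' _ h
    exact Finset.image_injective e.injective h

variable [CommRing A]

/-- The convolution product `U ↦ Σ_{I ⊔ J = U} f(I) h(J)` of two functions on finite sets. -/
def subsetConv (f h : Finset ι → A) (U : Finset ι) : A :=
  ∑ I ∈ U.powerset, f I * h (U \ I)

lemma subsetConv_comm (f h : Finset ι → A) : subsetConv f h = subsetConv h f := by
  funext U
  unfold subsetConv
  rw [sum_powerset_sdiff fun I J => f I * h J]
  simp only [mul_comm]

lemma subsetConv_assoc (f h k : Finset ι → A) :
    subsetConv (subsetConv f h) k = subsetConv f (subsetConv h k) := by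
  funext U
  simp only [subsetConv, Finset.sum_mul, Finset.mul_sum]
  rw [sum_powerset_powerset fun I J L => f I * h J * k L,
    ← sum_powerset_powerset_sdiff fun I J L => f I * h J * k L]
  simp only [mul_assoc]

/-- If `s` is additive on disjoint unions, multiplication by `s` is a derivation of the
convolution product. -/
lemma subsetConv_leibniz (s f h : Finset ι → A) (U : Finset ι)
    (hs : ∀ I ⊆ U, s U = s I + s (U \ I)) :
    s U * subsetConv f h U =
      subsetConv (fun I => s I * f I) h U + subsetConv f (fun I => s I * h I) U := by
  simp only [subsetConv, Finset.mul_sum, ← Finset.sum_add_distrib]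
  refine Finset.sum_congr rfl fun I hI => ?_
  rw [hs I (by simpa using hI)]
  ring

end SubsetConvolution

/-! ### The functions `S² F_g` over an arbitrary `ℚ`-algebra -/

section PowerSeriesEuler

variable {A : Type*} [CommRing A]

/-- The derivation `2 ℏ d/dℏ` of `A⟦ℏ⟧`. -/
def eulerD (A : Type*) [CommRing A] : Derivation A (PowerSeries A) (PowerSeries A) :=
  (2 * PowerSeries.X : PowerSeries A) • PowerSeries.derivative A

lemma coeff_eulerD (f : PowerSeries A) (g : ℕ) :
    PowerSeries.coeff g (eulerD A f) = 2 * g * PowerSeries.coeff g f := by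
  have h2 : (2 : PowerSeries A) = PowerSeries.C 2 := (map_ofNat _ 2).symm
  rw [eulerD, Derivation.smul_apply, smul_eq_mul, h2, mul_assoc, PowerSeries.coeff_C_mul]
  cases g with
  | zero => simp
  | succ g =>
    rw [PowerSeries.coeff_succ_X_mul, PowerSeries.coeff_derivative]
    push_cast
    ring

lemma eulerD_mul (f h : PowerSeries A) :
    eulerD A (f * h) = eulerD A f * h + f * eulerD A h := by
  rw [Derivation.leibniz, smul_eq_mul, smul_eq_mul]
  ring

lemma eulerD_C_mul (a : A) (f : PowerSeries A) :
    eulerD A (PowerSeries.C a * f) = PowerSeries.C a * eulerD A f := by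
  rw [← PowerSeries.smul_eq_C_mul, Derivation.map_smul, PowerSeries.smul_eq_C_mul]

lemma eulerD_rescale_exp [Algebra ℚ A] (a : A) :
    eulerD A (PowerSeries.rescale a (PowerSeries.exp A)) =
      2 * PowerSeries.C a * PowerSeries.X * PowerSeries.rescale a (PowerSeries.exp A) := by
  have h2 : (2 : PowerSeries A) = PowerSeries.C 2 := (map_ofNat _ 2).symm
  ext g
  rw [coeff_eulerD, h2, ← map_mul, mul_assoc (PowerSeries.C _), PowerSeries.coeff_C_mul]
  cases g with
  | zero => simp
  | succ g =>
    rw [PowerSeries.coeff_succ_X_mul, PowerSeries.coeff_rescale, PowerSeries.coeff_rescale,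
      PowerSeries.coeff_exp, PowerSeries.coeff_exp]
    have h : ((g + 1 : ℕ) : A) * algebraMap ℚ A (1 / ((g + 1).factorial : ℚ)) =
        algebraMap ℚ A (1 / (g.factorial : ℚ)) := by
      rw [← map_natCast (algebraMap ℚ A), ← map_mul]
      congr 1
      rw [Nat.factorial_succ]
      have := Nat.factorial_ne_zero g
      push_cast
      field_simp
    rw [← h]
    ring

lemma intCast_mul_cancel [Algebra ℚ A] {m : ℤ} (hm : m ≠ 0) {a b : A}
    (h : (m : A) * a = m * b) : a = b := by
  have hu : algebraMap ℚ A (m : ℚ)⁻¹ * (m : A) = 1 := by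
    rw [← map_intCast (algebraMap ℚ A), ← map_mul, inv_mul_cancel₀ (by exact_mod_cast hm), map_one]
  calc a = algebraMap ℚ A (m : ℚ)⁻¹ * (m : A) * a := by rw [hu, one_mul]
    _ = algebraMap ℚ A (m : ℚ)⁻¹ * (m : A) * b := by rw [mul_assoc, h, mul_assoc]
    _ = b := by rw [hu, one_mul]

lemma coeff_quadRec_lhs (f : PowerSeries A) (n g : ℕ) :
    PowerSeries.coeff g (12 * (eulerD A f + ((n : PowerSeries A) - 1) * f)) =
      ((12 * (2 * g + n - 1) : ℤ) : A) * PowerSeries.coeff g f := by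
  have h : 12 * (eulerD A f + ((n : PowerSeries A) - 1) * f) =
      PowerSeries.C 12 * eulerD A f + PowerSeries.C (12 * ((n : A) - 1)) * f := by
    simp only [map_mul, map_sub, map_natCast, map_one, map_ofNat]
    ring
  rw [h, map_add, PowerSeries.coeff_C_mul, PowerSeries.coeff_C_mul, coeff_eulerD]
  push_cast
  ring

lemma coeff_X_mul_eq (f : PowerSeries A) (g : ℕ) :
    PowerSeries.coeff g (PowerSeries.X * f) =
      if 0 < g then PowerSeries.coeff (g - 1) f else 0 := by
  cases g with
  | zero => simp
  | succ g => simp [PowerSeries.coeff_succ_X_mul]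

lemma coeff_subsetConv {ι : Type*} [DecidableEq ι] (f : Finset ι → PowerSeries A) (hf : f ∅ = 0)
    (I : Finset ι) (g : ℕ) :
    PowerSeries.coeff g (subsetConv f f I) = ∑ J ∈ I.powerset,
      if J ⊂ I ∧ J.Nonempty then
        ∑ p ∈ antidiagonal g, PowerSeries.coeff p.1 (f J) * PowerSeries.coeff p.2 (f (I \ J))
      else 0 := by
  rw [subsetConv, map_sum]
  refine Finset.sum_congr rfl fun J hJ => ?_
  split_ifs with h
  · rw [PowerSeries.coeff_mul]
  · rcases Finset.eq_empty_or_nonempty J with rfl | hne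
    · simp [hf]
    · have : J = I := by
        by_contra hJI
        exact h ⟨(Finset.mem_powerset.1 hJ).ssubset_of_ne hJI, hne⟩
      simp [this, hf]

end PowerSeriesEuler

section Npt

variable {ι : Type*} [DecidableEq ι] {A : Type*} [CommRing A] [Algebra ℚ A]

/-- The function `(Σ_{i ∈ I} x_i)^2 F_g(x_I)`, which has a recursion free of denominators. -/
def npt (x : ι → A) (I : Finset ι) (g : ℕ) : A :=
  if I.card = 1 ∧ g = 0 then 1
  else
    algebraMap ℚ A (12 * (2 * (g : ℚ) + I.card - 1))⁻¹ *
      ((∑ i ∈ I, x i) ^ 3 * (if _h : 0 < g then npt x I (g - 1) else 0) +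
        6 * (∑ i ∈ I, x i) * ∑ J ∈ I.powerset,
          if _h : J ⊂ I ∧ J.Nonempty then
            ∑ p ∈ antidiagonal g, npt x J p.1 * npt x (I \ J) p.2
          else 0)
termination_by (I.card, g)
decreasing_by
  · exact Prod.Lex.right _ (by omega)
  · exact Prod.Lex.left _ _ (Finset.card_lt_card _h.1)
  · exact Prod.Lex.left _ _ (Finset.card_lt_card (Finset.sdiff_ssubset _h.1.1 _h.2))

/-- The generating series `Σ_g (Σ_{i ∈ I} x_i)^2 F_g(x_I) ℏ^g`. -/
def nptSeries (x : ι → A) (I : Finset ι) : PowerSeries A := PowerSeries.mk (npt x I)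

lemma nptSeries_empty (x : ι → A) : nptSeries x ∅ = 0 := by
  ext g
  rw [nptSeries, PowerSeries.coeff_mk, npt]
  simp

lemma nptSeries_singleton_coeff_zero (x : ι → A) (i : ι) :
    PowerSeries.coeff 0 (nptSeries x {i}) = 1 := by
  rw [nptSeries, PowerSeries.coeff_mk, npt]
  simp

/-- `f` satisfies the quadratic recursion of the functions `S² F_g`. -/
def QuadRec (x : ι → A) (f : Finset ι → PowerSeries A) (I : Finset ι) : Prop :=
  12 * (eulerD A (f I) + ((I.card : PowerSeries A) - 1) * f I) =
    PowerSeries.C ((∑ i ∈ I, x i) ^ 3) * (PowerSeries.X * f I) +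
      PowerSeries.C (6 * ∑ i ∈ I, x i) * subsetConv f f I

lemma nptSeries_quadRec (x : ι → A) (I : Finset ι) : QuadRec x (nptSeries x) I := by
  unfold QuadRec
  ext g
  rw [coeff_quadRec_lhs, map_add, PowerSeries.coeff_C_mul, PowerSeries.coeff_C_mul,
    coeff_X_mul_eq, coeff_subsetConv _ (nptSeries_empty x)]
  simp only [nptSeries, PowerSeries.coeff_mk]
  by_cases h : I.card = 1 ∧ g = 0
  · obtain ⟨⟨i, rfl⟩, rfl⟩ := And.imp_left Finset.card_eq_one.1 h
    have : ∀ J : Finset ι, ¬ (J ⊂ {i} ∧ J.Nonempty) := by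
      rintro J ⟨h1, h2⟩
      rw [Finset.ssubset_singleton_iff] at h1
      exact h2.ne_empty h1
    rw [Finset.sum_eq_zero fun J _ => dif_neg (this J)]
    simp
  · conv_lhs => rw [npt]
    rw [if_neg h, ← mul_assoc, ← map_intCast (algebraMap ℚ A), ← map_mul]
    have : ((12 * (2 * g + I.card - 1) : ℤ) : ℚ) * (12 * (2 * (g : ℚ) + I.card - 1))⁻¹ = 1 := by
      push_cast
      refine mul_inv_cancel₀ ?_
      have : (12 * (2 * g + I.card - 1) : ℤ) ≠ 0 := by omega
      have := (Int.cast_ne_zero (α := ℚ)).2 this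
      push_cast at this
      exact this
    rw [this, map_one, one_mul]
    simp only [dite_eq_ite]

/-- Uniqueness of the solution of the quadratic recursion. -/
lemma eq_nptSeries (x : ι → A) (f : Finset ι → PowerSeries A) (h0 : f ∅ = 0)
    (h1 : ∀ i, PowerSeries.coeff 0 (f {i}) = 1) (hf : ∀ I, QuadRec x f I) (I : Finset ι) :
    f I = nptSeries x I := by
  induction I using Finset.strongInduction with
  | H I ih =>
  ext g
  induction g with
  | zero =>
    by_cases hI : I.card = 1
    · obtain ⟨i, rfl⟩ := Finset.card_eq_one.1 hI
      rw [h1, nptSeries_singleton_coeff_zero]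
    have e1 := congrArg (PowerSeries.coeff 0) (hf I)
    have e2 := congrArg (PowerSeries.coeff 0) (nptSeries_quadRec x I)
    rw [coeff_quadRec_lhs, map_add, PowerSeries.coeff_C_mul, PowerSeries.coeff_C_mul,
      coeff_X_mul_eq, coeff_subsetConv _ h0, if_neg (lt_irrefl 0)] at e1
    rw [coeff_quadRec_lhs, map_add, PowerSeries.coeff_C_mul, PowerSeries.coeff_C_mul,
      coeff_X_mul_eq, coeff_subsetConv _ (nptSeries_empty x), if_neg (lt_irrefl 0)] at e2
    refine intCast_mul_cancel (m := 12 * (2 * (0 : ℕ) + I.card - 1)) (by omega) ?_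
    rw [e1, e2]
    congr 2
    refine Finset.sum_congr rfl fun J _ => ?_
    split_ifs with h
    · rw [ih J h.1, ih (I \ J) (Finset.sdiff_ssubset h.1.1 h.2)]
    · rfl
  | succ g ihg =>
    have e1 := congrArg (PowerSeries.coeff (g + 1)) (hf I)
    have e2 := congrArg (PowerSeries.coeff (g + 1)) (nptSeries_quadRec x I)
    rw [coeff_quadRec_lhs, map_add, PowerSeries.coeff_C_mul, PowerSeries.coeff_C_mul,
      coeff_X_mul_eq, coeff_subsetConv _ h0, if_pos g.succ_pos, Nat.add_sub_cancel] at e1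
    rw [coeff_quadRec_lhs, map_add, PowerSeries.coeff_C_mul, PowerSeries.coeff_C_mul,
      coeff_X_mul_eq, coeff_subsetConv _ (nptSeries_empty x), if_pos g.succ_pos,
      Nat.add_sub_cancel] at e2
    refine intCast_mul_cancel (m := 12 * (2 * (g + 1 : ℕ) + I.card - 1)) (by omega) ?_
    rw [e1, e2, ihg]
    congr 2
    refine Finset.sum_congr rfl fun J _ => ?_
    split_ifs with h
    · rw [ih J h.1, ih (I \ J) (Finset.sdiff_ssubset h.1.1 h.2)]
    · rfl

lemma nptSeries_comp_embedding {κ : Type*} [DecidableEq κ] (x : ι → A) (e : κ ↪ ι)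
    (I : Finset κ) : nptSeries x (I.map e) = nptSeries (x ∘ e) I := by
  refine eq_nptSeries (x ∘ e) (fun I => nptSeries x (I.map e)) ?_ ?_ ?_ I
  · simp [nptSeries_empty]
  · simp [nptSeries_singleton_coeff_zero]
  · intro I
    have h := nptSeries_quadRec x (I.map e)
    unfold QuadRec subsetConv at h ⊢
    rw [Finset.sum_map, Finset.card_map, sum_powerset_map] at h
    simp only [Function.comp_apply, Finset.map_sdiff]
    exact h

lemma map_nptSeries {B : Type*} [CommRing B] [Algebra ℚ B] (φ : A →+* B) (x : ι → A)
    (I : Finset ι) : PowerSeries.map φ (nptSeries x I) = nptSeries (φ ∘ x) I := by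
  refine eq_nptSeries (φ ∘ x) (fun I => PowerSeries.map φ (nptSeries x I)) ?_ ?_ ?_ I
  · simp [nptSeries_empty]
  · simp [nptSeries_singleton_coeff_zero]
  · intro I
    have h := congrArg (PowerSeries.map φ) (nptSeries_quadRec x I)
    have hd : ∀ f : PowerSeries A,
        PowerSeries.map φ (eulerD A f) = eulerD B (PowerSeries.map φ f) := by
      intro f
      ext g
      simp [coeff_eulerD, map_ofNat]
    unfold QuadRec subsetConv at *
    simpa [hd, map_ofNat] using h

end Npt

section Divisibility

variable {ι : Type*} [DecidableEq ι] {A : Type*} [CommRing A] [Algebra ℚ A]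

/-- Conservation law for the quadratic recursion: up to a scalar factor, the self-convolution
of the solution is divisible by the sum of the variables. -/
lemma exists_eulerD_subsetConv_eq (x : ι → A) (U : Finset ι) :
    ∃ T : PowerSeries A,
      12 * (eulerD A (subsetConv (nptSeries x) (nptSeries x) U) +
        ((U.card : PowerSeries A) - 2) * subsetConv (nptSeries x) (nptSeries x) U) =
      PowerSeries.C (∑ i ∈ U, x i) * T := by
  set f := nptSeries x with hf
  let s : Finset ι → PowerSeries A := fun I => PowerSeries.C (∑ i ∈ I, x i)
  have hs : ∀ V : Finset ι, ∀ I ⊆ V, s V = s I + s (V \ I) := fun V I hI => by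
    simp only [s]
    rw [← map_add, add_comm, Finset.sum_sdiff hI]
  let D : (Finset ι → PowerSeries A) → Finset ι → PowerSeries A := fun h I => s I * h I
  have hD : ∀ h k, D (subsetConv h k) = subsetConv (D h) k + subsetConv h (D k) :=
    fun h k => funext fun V => subsetConv_leibniz s h k V (hs V)
  have hadd : ∀ h k l : Finset ι → PowerSeries A,
      subsetConv (h + k) l = subsetConv h l + subsetConv k l := fun h k l => by
    funext V
    simp [subsetConv, add_mul, Finset.sum_add_distrib]
  set q := subsetConv f f with hq
  have hDq : D q = subsetConv (D f) f + subsetConv (D f) f := by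
    rw [hD, subsetConv_comm f (D f)]
  have h1 : subsetConv (D q) f U = 2 * subsetConv (subsetConv (D f) f) f U := by
    rw [hDq, hadd, two_mul]
    rfl
  have h2 : s U * subsetConv q f U = 3 * subsetConv (subsetConv (D f) f) f U := by
    have h3 : s U * subsetConv q f U = (subsetConv (D q) f + subsetConv q (D f)) U :=
      congrFun (hD q f) U
    have h4 : subsetConv q (D f) = subsetConv (subsetConv (D f) f) f := by
      rw [hq, subsetConv_comm, ← subsetConv_assoc]
    rw [Pi.add_apply, h1, h4] at h3
    linear_combination h3
  have h3 : subsetConv f (D q) U = subsetConv (D q) f U := by rw [subsetConv_comm]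
  let c : PowerSeries A := ∑ I ∈ U.powerset,
    (s I ^ 2 - s I * s (U \ I) + s (U \ I) ^ 2) * (f I * f (U \ I))
  have h4 : 12 * (eulerD A (q U) + ((U.card : PowerSeries A) - 2) * q U) =
      s U * (PowerSeries.X * c) + 6 * subsetConv (D q) f U + 6 * subsetConv f (D q) U := by
    simp only [hq, subsetConv, map_sum, c, Finset.mul_sum, ← Finset.sum_add_distrib]
    refine Finset.sum_congr rfl fun I hI => ?_
    have hI := Finset.mem_powerset.1 hI
    have e1 := nptSeries_quadRec x I
    have e2 := nptSeries_quadRec x (U \ I)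
    unfold QuadRec at e1 e2
    rw [← hf, ← hq, map_mul, map_ofNat, map_pow] at e1 e2
    have hc : (U.card : PowerSeries A) = I.card + (U \ I).card := by
      rw [← Finset.card_sdiff_add_card_eq_card hI]
      push_cast
      ring
    rw [eulerD_mul, hs U I hI, hc]
    simp only [D, s]
    change _ = _ + 6 * (_ * q I * _) + 6 * (_ * (_ * q (U \ I)))
    linear_combination f (U \ I) * e1 + f I * e2
  refine ⟨PowerSeries.X * c + 8 * subsetConv q f U, ?_⟩
  change _ = s U * _
  rw [h4, h3, h1]
  linear_combination (-8) * h2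

lemma exists_sq_mul_eq_coeff_nptSeries (x : ι → A) (U : Finset ι) (g : ℕ) (hU : 1 ≤ U.card)
    (h : g ≠ 0 ∨ 2 < U.card) :
    ∃ p : A, (∑ i ∈ U, x i) ^ 2 * p = PowerSeries.coeff g (nptSeries x U) := by
  obtain ⟨T, hT⟩ := exists_eulerD_subsetConv_eq x U
  have e0 := congrArg (PowerSeries.coeff g) (nptSeries_quadRec x U)
  rw [coeff_quadRec_lhs, map_add, PowerSeries.coeff_C_mul, PowerSeries.coeff_C_mul,
    coeff_X_mul_eq] at e0
  set q := subsetConv (nptSeries x) (nptSeries x) U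
  set S := ∑ i ∈ U, x i
  have e1 := congrArg (PowerSeries.coeff g) hT
  have h2 : 12 * (eulerD A q + ((U.card : PowerSeries A) - 2) * q) =
      12 * (eulerD A q + ((U.card : PowerSeries A) - 1) * q) - PowerSeries.C 12 * q := by
    rw [map_ofNat]
    ring
  rw [h2, map_sub, coeff_quadRec_lhs, PowerSeries.coeff_C_mul, PowerSeries.coeff_C_mul] at e1
  obtain ⟨u, hu⟩ : ∃ u : A, ((12 * (2 * g + U.card - 2) : ℤ) : A) * u = 1 :=
    ⟨algebraMap ℚ A ((12 * (2 * g + U.card - 2) : ℤ) : ℚ)⁻¹, by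
      rw [← map_intCast (algebraMap ℚ A), ← map_mul, mul_inv_cancel₀, map_one]
      exact Int.cast_ne_zero.2 (by omega)⟩
  obtain ⟨v, hv⟩ : ∃ v : A, ((12 * (2 * g + U.card - 1) : ℤ) : A) * v = 1 :=
    ⟨algebraMap ℚ A ((12 * (2 * g + U.card - 1) : ℤ) : ℚ)⁻¹, by
      rw [← map_intCast (algebraMap ℚ A), ← map_mul, mul_inv_cancel₀, map_one]
      exact Int.cast_ne_zero.2 (by omega)⟩
  set r := if 0 < g then PowerSeries.coeff (g - 1) (nptSeries x U) else 0
  have e2 : PowerSeries.coeff g q = S * (u * PowerSeries.coeff g T) := by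
    push_cast at e1 hu
    linear_combination u * e1 - PowerSeries.coeff g q * hu
  refine ⟨v * (S * r + 6 * (u * PowerSeries.coeff g T)), ?_⟩
  rw [e2] at e0
  linear_combination (-v) * e0 + PowerSeries.coeff g (nptSeries x U) * hv

end Divisibility

section NormSeries

variable {ι : Type*} [DecidableEq ι] {A : Type*} [CommRing A] [Algebra ℚ A]

/-- The generating series `Σ_g (Σ_{i ∈ I} x_i)^2 G_g(x_I) ℏ^g`. -/
def normSeries (x : ι → A) (I : Finset ι) : PowerSeries A :=
  PowerSeries.rescale (algebraMap ℚ A (-1 / 24) * ∑ i ∈ I, x i ^ 3) (PowerSeries.exp A) *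
    nptSeries x I

lemma normSeries_empty (x : ι → A) : normSeries x ∅ = 0 := by
  rw [normSeries, nptSeries_empty, mul_zero]

lemma normSeries_singleton_coeff_zero (x : ι → A) (i : ι) :
    PowerSeries.coeff 0 (normSeries x {i}) = 1 := by
  have h := nptSeries_singleton_coeff_zero x i
  rw [PowerSeries.coeff_zero_eq_constantCoeff_apply] at h ⊢
  rw [normSeries, map_mul, h, mul_one, ← PowerSeries.coeff_zero_eq_constantCoeff_apply,
    PowerSeries.coeff_rescale]
  simp

lemma rescale_exp_mul_normSeries (x : ι → A) (I : Finset ι) :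
    PowerSeries.rescale (algebraMap ℚ A (1 / 24) * ∑ i ∈ I, x i ^ 3) (PowerSeries.exp A) *
      normSeries x I = nptSeries x I := by
  rw [normSeries, ← mul_assoc, PowerSeries.exp_mul_exp_eq_exp_add, ← add_mul, ← map_add]
  norm_num

lemma normSeries_quadRec (x : ι → A) (I : Finset ι) :
    12 * (eulerD A (normSeries x I) + ((I.card : PowerSeries A) - 1) * normSeries x I) =
      PowerSeries.C ((∑ i ∈ I, x i) ^ 3 - ∑ i ∈ I, x i ^ 3) * (PowerSeries.X * normSeries x I) +
        PowerSeries.C (6 * ∑ i ∈ I, x i) * subsetConv (normSeries x) (normSeries x) I := by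
  have hconv : subsetConv (normSeries x) (normSeries x) I =
      PowerSeries.rescale (algebraMap ℚ A (-1 / 24) * ∑ i ∈ I, x i ^ 3) (PowerSeries.exp A) *
        subsetConv (nptSeries x) (nptSeries x) I := by
    unfold subsetConv
    rw [Finset.mul_sum]
    refine Finset.sum_congr rfl fun J hJ => ?_
    rw [normSeries, normSeries, mul_mul_mul_comm, PowerSeries.exp_mul_exp_eq_exp_add, ← mul_add,
      add_comm, Finset.sum_sdiff (Finset.mem_powerset.1 hJ)]
  have hc : 24 * PowerSeries.C (algebraMap ℚ A (-1 / 24)) = (-1 : PowerSeries A) := by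
    rw [← map_ofNat PowerSeries.C 24, ← map_mul, ← map_ofNat (algebraMap ℚ A) 24, ← map_mul]
    norm_num
  have h := nptSeries_quadRec x I
  unfold QuadRec at h
  rw [hconv, normSeries, eulerD_mul, eulerD_rescale_exp, map_mul, map_sub]
  linear_combination PowerSeries.rescale (algebraMap ℚ A (-1 / 24) * ∑ i ∈ I, x i ^ 3)
    (PowerSeries.exp A) * h + PowerSeries.C (∑ i ∈ I, x i ^ 3) * PowerSeries.X *
    PowerSeries.rescale (algebraMap ℚ A (-1 / 24) * ∑ i ∈ I, x i ^ 3) (PowerSeries.exp A) *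
    nptSeries x I * hc

lemma coeff_normSeries_quadRec (x : ι → A) (I : Finset ι) (g : ℕ) :
    ((12 * (2 * g + I.card - 1) : ℤ) : A) * PowerSeries.coeff g (normSeries x I) =
      ((∑ i ∈ I, x i) ^ 3 - ∑ i ∈ I, x i ^ 3) *
        (if 0 < g then PowerSeries.coeff (g - 1) (normSeries x I) else 0) +
      6 * (∑ i ∈ I, x i) *
        PowerSeries.coeff g (subsetConv (normSeries x) (normSeries x) I) := by
  have h := congrArg (PowerSeries.coeff g) (normSeries_quadRec x I)
  rwa [coeff_quadRec_lhs, map_add, PowerSeries.coeff_C_mul, PowerSeries.coeff_C_mul,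
    coeff_X_mul_eq] at h

lemma normSeries_comp_embedding {κ : Type*} [DecidableEq κ] (x : ι → A) (e : κ ↪ ι)
    (I : Finset κ) : normSeries x (I.map e) = normSeries (x ∘ e) I := by
  rw [normSeries, normSeries, nptSeries_comp_embedding, Finset.sum_map]
  rfl

lemma map_normSeries {B : Type*} [CommRing B] [Algebra ℚ B] (φ : A →+* B) (x : ι → A)
    (I : Finset ι) : PowerSeries.map φ (normSeries x I) = normSeries (φ ∘ x) I := by
  have hexp : ∀ a : A, PowerSeries.map φ (PowerSeries.rescale a (PowerSeries.exp A)) =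
      PowerSeries.rescale (φ a) (PowerSeries.exp B) := by
    intro a
    ext g
    simp [PowerSeries.coeff_rescale, PowerSeries.coeff_exp]
  rw [normSeries, map_mul, map_nptSeries, hexp, normSeries]
  simp

end NormSeries

/-! ### The `n`-point functions are polynomials -/

/-- The variables `x_1, …, x_n` as elements of `K n`. -/
def varK (n : ℕ) (i : Fin n) : K n := algebraMap (R n) (K n) (X i)

lemma SX_eq (n : ℕ) : SX n = ∑ i, varK n i := by
  simp [SX, varK]

lemma SX3_eq (n : ℕ) : SX3 n = ∑ i, varK n i ^ 3 := by
  simp [SX3, varK]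

lemma sum_X_ne_zero {n : ℕ} (hn : n ≠ 0) : (∑ i, X i : R n) ≠ 0 := by
  intro h
  have h1 := congrArg (MvPolynomial.eval fun _ => (1 : ℚ)) h
  simp at h1
  exact hn h1

lemma SX_ne_zero {n : ℕ} (hn : n ≠ 0) : SX n ≠ 0 := by
  rw [SX, Ne, map_eq_zero_iff _ (IsFractionRing.injective (R n) (K n))]
  exact sum_X_ne_zero hn

/-- The increasing enumeration of `I`, as an embedding. -/
def enumEmb {n : ℕ} (I : Finset (Fin n)) : Fin I.card ↪ Fin n :=
  ⟨fun i => ((I.orderIsoOfFin rfl) i : Fin n), fun _ _ h =>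
    (I.orderIsoOfFin rfl).injective (Subtype.val_injective h)⟩

lemma map_enumEmb {n : ℕ} (I : Finset (Fin n)) : univ.map (enumEmb I) = I := by
  ext i
  simp only [mem_map, mem_univ, true_and]
  constructor
  · rintro ⟨j, rfl⟩
    exact ((I.orderIsoOfFin rfl) j).2
  · intro hi
    exact ⟨(I.orderIsoOfFin rfl).symm ⟨i, hi⟩,
      congrArg Subtype.val ((I.orderIsoOfFin rfl).apply_symm_apply ⟨i, hi⟩)⟩

lemma emb_varK {n : ℕ} (I : Finset (Fin n)) : emb I ∘ varK I.card = varK n ∘ enumEmb I := by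
  funext i
  simp only [Function.comp_apply, varK, emb, IsFractionRing.lift_algebraMap, embRH]
  simp [enumEmb]

lemma emb_coeff_normSeries {n : ℕ} (I : Finset (Fin n)) (g : ℕ) :
    emb I (PowerSeries.coeff g (normSeries (varK I.card) univ)) =
      PowerSeries.coeff g (normSeries (varK n) I) := by
  rw [← PowerSeries.coeff_map, map_normSeries, emb_varK, ← normSeries_comp_embedding, map_enumEmb]

lemma emb_SX {n : ℕ} (I : Finset (Fin n)) :
    emb I (SX I.card) = algebraMap (R n) (K n) (∑ i ∈ I, X i) := by
  have h : ∀ i, emb I (varK I.card i) = varK n (enumEmb I i) := congrFun (emb_varK I)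
  rw [SX_eq, map_sum, map_sum]
  conv_rhs => rw [← map_enumEmb I, Finset.sum_map]
  exact Finset.sum_congr rfl fun i _ => h i

/-- The double factorial sum in the definition of `G_g` solves a first order recursion. -/
lemma doubleFactorial_sum_rec {L : Type*} [Field L] [CharZero L] (n : ℕ) (q : ℕ → L) (D : L)
    (g : ℕ) :
    (2 * g + n + 1 : L) * (∑ s ∈ Finset.range (g + 1),
      ((Nat.doubleFactorial (2 * (g - s) + (n + 2) - 3) : ℕ) : L) /
          (4 ^ s * ((Nat.doubleFactorial (2 * g + (n + 2) - 1) : ℕ) : L)) * q (g - s) * D ^ s) =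
      q g + D / 4 * (if 0 < g then ∑ s ∈ Finset.range g,
        ((Nat.doubleFactorial (2 * (g - 1 - s) + (n + 2) - 3) : ℕ) : L) /
          (4 ^ s * ((Nat.doubleFactorial (2 * (g - 1) + (n + 2) - 1) : ℕ) : L)) *
            q (g - 1 - s) * D ^ s else 0) := by
  have hpos : (2 * g + n + 1 : L) ≠ 0 := by exact_mod_cast (2 * g + n).succ_ne_zero
  have h0 : ((Nat.doubleFactorial (2 * g + (n + 2) - 1) : ℕ) : L) =
      (2 * g + n + 1) * (Nat.doubleFactorial (2 * g + (n + 2) - 3) : ℕ) := by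
    rcases Nat.eq_zero_or_pos (2 * g + n) with h | h
    · obtain ⟨rfl, rfl⟩ : g = 0 ∧ n = 0 := by omega
      simp
    · obtain ⟨m, hm⟩ : ∃ m, 2 * g + n = m + 1 := ⟨2 * g + n - 1, by omega⟩
      have e1 : 2 * g + (n + 2) - 1 = m + 2 := by omega
      have e2 : 2 * g + (n + 2) - 3 = m := by omega
      rw [e1, e2, Nat.doubleFactorial_add_two]
      have : (2 * g + n : L) = m + 1 := by exact_mod_cast hm
      rw [this]
      push_cast
      ring
  have hne : ∀ m : ℕ, ((Nat.doubleFactorial m : ℕ) : L) ≠ 0 := fun m =>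
    Nat.cast_ne_zero.2 (Nat.doubleFactorial_pos m).ne'
  rw [Finset.sum_range_succ', mul_add]
  rw [add_comm]
  congr 1
  · simp only [Nat.sub_zero, pow_zero, one_mul, mul_one]
    rw [h0]
    have := hne (2 * g + (n + 2) - 3)
    field_simp
  · cases g with
    | zero => simp
    | succ g =>
      rw [if_pos g.succ_pos, Finset.mul_sum, Finset.mul_sum]
      refine Finset.sum_congr rfl fun s _ => ?_
      have e1 : 2 * (g + 1) + (n + 2) - 1 = (2 * g + (n + 2) - 1) + 2 := by omega
      have e2 : 2 * g + (n + 2) - 1 + 2 = 2 * (g + 1) + n + 1 := by omega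
      rw [e1, Nat.doubleFactorial_add_two, e2, Nat.add_sub_add_right, Nat.add_sub_cancel]
      have := hne (2 * g + (n + 2) - 1)
      push_cast at hpos ⊢
      field_simp
      ring

lemma sq_SX_mul_Gf (fuel n : ℕ) (h : n ≤ fuel) (g : ℕ) :
    SX n ^ 2 * Gf fuel n g = PowerSeries.coeff g (normSeries (varK n) univ) := by
  induction fuel generalizing n g with
  | zero =>
    obtain rfl : n = 0 := by omega
    rw [Gf, univ_eq_empty, normSeries_empty]
    simp
  | succ fuel ih =>
    match n, g with
    | 0, g =>
      rw [Gf, univ_eq_empty, normSeries_empty]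
      simp
    | 1, 0 =>
      rw [show (univ : Finset (Fin 1)) = {0} from rfl, normSeries_singleton_coeff_zero, Gf]
      have h1 := SX_ne_zero one_ne_zero
      have h2 : algebraMap (R 1) (K 1) (X 0) = SX 1 := by simp [SX]
      rw [h2, zpow_neg]
      exact mul_inv_cancel₀ (pow_ne_zero 2 h1)
    | 1, g + 1 =>
      rw [Gf, mul_zero]
      have hconv : PowerSeries.coeff (g + 1)
          (subsetConv (normSeries (varK 1)) (normSeries (varK 1)) univ) = 0 := by
        rw [coeff_subsetConv _ (normSeries_empty _)]
        refine Finset.sum_eq_zero fun J _ => if_neg ?_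
        rintro ⟨h1, h2⟩
        rw [show (univ : Finset (Fin 1)) = {0} from rfl, Finset.ssubset_singleton_iff] at h1
        exact h2.ne_empty h1
      have h1 := coeff_normSeries_quadRec (varK 1) univ (g + 1)
      rw [hconv] at h1
      refine (intCast_mul_cancel
        (m := 12 * (2 * (g + 1 : ℕ) + (univ : Finset (Fin 1)).card - 1))
        (by simp; omega) ?_).symm
      rw [h1]
      simp
    | n + 2, g =>
      set S := SX (n + 2) with hS
      have hS0 : S ≠ 0 := SX_ne_zero (by omega)
      set Q : ℕ → K (n + 2) := fun r => PowerSeries.coeff r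
        (subsetConv (normSeries (varK (n + 2))) (normSeries (varK (n + 2))) univ) with hQ
      have hinner : ∀ r, (∑ I : Finset (Fin (n+2)),
            if I ≠ ∅ ∧ I ≠ univ then
              (algebraMap (R (n+2)) (K (n+2)) (∑ i ∈ I, X i))^2 *
              (algebraMap (R (n+2)) (K (n+2)) (∑ i ∈ Iᶜ, X i))^2 *
              ∑ r' ∈ Finset.range (r+1),
                emb I (Gf fuel I.card r') * emb Iᶜ (Gf fuel Iᶜ.card (r - r'))
            else 0) = Q r := by
        intro r
        rw [hQ]
        simp only
        rw [coeff_subsetConv _ (normSeries_empty _), Finset.powerset_univ]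
        refine Finset.sum_congr rfl fun I _ => ?_
        have hiff : (I ≠ ∅ ∧ I ≠ univ) ↔ (I ⊂ univ ∧ I.Nonempty) := by
          rw [Finset.ssubset_univ_iff, Finset.nonempty_iff_ne_empty, and_comm]
        simp only [hiff]
        split_ifs with hI
        · rw [Finset.Nat.sum_antidiagonal_eq_sum_range_succ (fun a b =>
            PowerSeries.coeff a (normSeries (varK (n + 2)) I) *
              PowerSeries.coeff b (normSeries (varK (n + 2)) (univ \ I))), Finset.mul_sum]
          refine Finset.sum_congr rfl fun r' _ => ?_
          have c1 : I.card ≤ fuel := by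
            have := Finset.card_lt_card hI.1
            simp at this
            omega
          have c2 : Iᶜ.card ≤ fuel := by
            have := hI.2.card_pos
            rw [Finset.card_compl, Fintype.card_fin]
            omega
          rw [← Finset.compl_eq_univ_sdiff, ← emb_coeff_normSeries I, ← emb_coeff_normSeries Iᶜ,
            ← ih _ c1, ← ih _ c2, map_mul, map_mul, map_pow, map_pow, emb_SX, emb_SX]
          ring
        · rfl
      have hD : S ^ 3 - SX3 (n + 2) = 3 * Dlt (n + 2) := by
        rw [Dlt]
        ring
      have hrec : ∀ g : ℕ, (12 * (2 * (g : K (n + 2)) + n + 1) : K (n + 2)) *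
          PowerSeries.coeff g (normSeries (varK (n + 2)) univ) =
          3 * Dlt (n + 2) * (if 0 < g then
            PowerSeries.coeff (g - 1) (normSeries (varK (n + 2)) univ) else 0) +
          6 * S * Q g := by
        intro g
        have h1 := coeff_normSeries_quadRec (varK (n + 2)) univ g
        rw [← SX_eq, ← SX3_eq, hD] at h1
        rw [← h1]
        simp only [card_univ, Fintype.card_fin]
        push_cast
        ring
      rw [Gf]
      simp only [hinner, Rat.cast_natCast, ← hS]
      have hG := fun g => doubleFactorial_sum_rec n (fun r => (2 * S)⁻¹ * Q r) (Dlt (n + 2)) g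
      clear_value Q
      induction g with
      | zero =>
        have h1 := hG 0
        have h2 := hrec 0
        simp only [lt_self_iff_false, if_false] at h1 h2
        have hne : (2 * (0 : ℕ) + n + 1 : K (n + 2)) ≠ 0 := by
          exact_mod_cast (2 * 0 + n).succ_ne_zero
        refine mul_left_cancel₀ hne (mul_left_cancel₀ (by norm_num : (12 : K (n + 2)) ≠ 0) ?_)
        have h3 : S ^ 2 * ((2 * S)⁻¹ * Q 0) = S * Q 0 / 2 := by field_simp
        linear_combination 12 * S ^ 2 * h1 - h2 + 12 * h3
      | succ g ihg =>
        have h1 := hG (g + 1)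
        have h2 := hrec (g + 1)
        simp only [Nat.succ_pos, if_true, Nat.add_sub_cancel] at h1 h2
        have hne : (2 * (g + 1 : ℕ) + n + 1 : K (n + 2)) ≠ 0 := by
          exact_mod_cast (2 * (g + 1) + n).succ_ne_zero
        refine mul_left_cancel₀ hne (mul_left_cancel₀ (by norm_num : (12 : K (n + 2)) ≠ 0) ?_)
        have h3 : S ^ 2 * ((2 * S)⁻¹ * Q (g + 1)) = S * Q (g + 1) / 2 := by field_simp
        linear_combination 12 * S ^ 2 * h1 - h2 + 12 * h3 + 3 * Dlt (n + 2) * ihg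

lemma sq_SX_mul_Fnpt (n g : ℕ) :
    SX n ^ 2 * Fnpt n g = PowerSeries.coeff g (nptSeries (varK n) univ) := by
  rw [← rescale_exp_mul_normSeries, PowerSeries.coeff_mul,
    Finset.Nat.sum_antidiagonal_eq_sum_range_succ (fun a b =>
      PowerSeries.coeff a (PowerSeries.rescale (algebraMap ℚ (K n) (1 / 24) *
        ∑ i, varK n i ^ 3) (PowerSeries.exp (K n))) *
      PowerSeries.coeff b (normSeries (varK n) univ)), Fnpt, Finset.mul_sum]
  refine Finset.sum_congr rfl fun d _ => ?_
  rw [← sq_SX_mul_Gf n n le_rfl, ← SX3_eq, PowerSeries.coeff_rescale, PowerSeries.coeff_exp, Gnpt]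
  simp only [eq_ratCast]
  push_cast
  ring

/-- The polynomial representing `F_g(x_1,…,x_n)`. -/
lemma sq_mul_polyOf_Fnpt (n g : ℕ) (hn : 1 ≤ n) (h : g ≠ 0 ∨ 2 < n) :
    (∑ i, X i) ^ 2 * polyOf (Fnpt n g) =
      PowerSeries.coeff g (nptSeries (X : Fin n → R n) univ) := by
  obtain ⟨p, hp⟩ := exists_sq_mul_eq_coeff_nptSeries (X : Fin n → R n) univ g
    (by simpa using hn) (by simpa using h)
  have hF : algebraMap (R n) (K n) p = Fnpt n g := by
    refine mul_left_cancel₀ (pow_ne_zero 2 (SX_ne_zero (show n ≠ 0 by omega))) ?_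
    rw [sq_SX_mul_Fnpt, SX, ← map_pow, ← map_mul, hp, ← PowerSeries.coeff_map, map_nptSeries]
    rfl
  have hex : ∃ p : R n, algebraMap (R n) (K n) p = Fnpt n g := ⟨p, hF⟩
  have hpol : polyOf (Fnpt n g) = p := by
    rw [polyOf, dif_pos hex]
    exact IsFractionRing.injective (R n) (K n) (hex.choose_spec.trans hF.symm)
  rw [hpol, hp]

/-! ### A distinguished point -/

section PointedSeries

lemma none_notMem_map_some {ι : Type*} (I : Finset ι) : none ∉ I.map Function.Embedding.some := by simp

variable {ι : Type*} [DecidableEq ι] {A : Type*} [CommRing A]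

/-- The finite set `I` together with an additional point `none`. -/
def pointedSet (I : Finset ι) : Finset (Option ι) := insert none (I.map Function.Embedding.some)

lemma sum_pointedSet {M : Type*} [AddCommMonoid M] (x : Option ι → M) (I : Finset ι) :
    ∑ i ∈ pointedSet I, x i = x none + ∑ i ∈ I, x (some i) := by
  rw [pointedSet, Finset.sum_insert (none_notMem_map_some I), Finset.sum_map]
  rfl

lemma card_pointedSet (I : Finset ι) : (pointedSet I).card = I.card + 1 := by
  rw [pointedSet, Finset.card_insert_of_notMem (none_notMem_map_some I), Finset.card_map]

lemma pointedSet_sdiff_map (I J : Finset ι) :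
    pointedSet I \ J.map Function.Embedding.some = pointedSet (I \ J) := by
  ext (_ | i) <;> simp [pointedSet]

lemma pointedSet_sdiff_pointedSet (I J : Finset ι) :
    pointedSet I \ pointedSet J = (I \ J).map Function.Embedding.some := by
  ext (_ | i) <;> simp [pointedSet]

lemma subsetConv_pointedSet (f : Finset (Option ι) → A) (I : Finset ι) :
    subsetConv f f (pointedSet I) =
      2 * ∑ B ∈ I.powerset, f (pointedSet B) * f ((I \ B).map Function.Embedding.some) := by
  rw [subsetConv, pointedSet, Finset.sum_powerset_insert (none_notMem_map_some I),
    sum_powerset_map, sum_powerset_map]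
  change ∑ J ∈ I.powerset, f (J.map _) * f (pointedSet I \ J.map _) +
    ∑ J ∈ I.powerset, f (pointedSet J) * f (pointedSet I \ pointedSet J) = _
  simp only [pointedSet_sdiff_map, pointedSet_sdiff_pointedSet]
  rw [sum_powerset_sdiff fun J B => f (pointedSet J) * f (B.map Function.Embedding.some), two_mul]
  simp only [mul_comm]

variable [Algebra ℚ A]

/-- The series `S² F_g` with one distinguished argument `x none` and the arguments in `I`. -/
def pointedSeries (x : Option ι → A) (I : Finset ι) : PowerSeries A :=
  nptSeries x (pointedSet I)

lemma pointedSeries_rec (x : Option ι → A) (I : Finset ι) :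
    12 * (eulerD A (pointedSeries x I) + (I.card : PowerSeries A) * pointedSeries x I) =
      PowerSeries.C ((x none + ∑ i ∈ I, x (some i)) ^ 3) *
          (PowerSeries.X * pointedSeries x I) +
        12 * PowerSeries.C (x none + ∑ i ∈ I, x (some i)) *
          ∑ B ∈ I.powerset, pointedSeries x B * nptSeries (x ∘ some) (I \ B) := by
  have h := nptSeries_quadRec x (pointedSet I)
  rw [QuadRec, subsetConv_pointedSet, sum_pointedSet, card_pointedSet] at h
  have h6 : (PowerSeries.C 6 : PowerSeries A) = 6 := map_ofNat _ 6
  simp only [nptSeries_comp_embedding] at h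
  rw [map_mul, h6] at h
  push_cast at h
  rw [add_sub_cancel_right] at h
  refine h.trans ?_
  simp only [pointedSeries]
  rw [show x ∘ (Function.Embedding.some : ι ↪ Option ι) = x ∘ some from rfl]
  ring

lemma pointedSeries_empty_coeff_zero (x : Option ι → A) :
    PowerSeries.coeff 0 (pointedSeries x ∅) = 1 := by
  rw [pointedSeries, pointedSet, Finset.map_empty, insert_empty_eq]
  exact nptSeries_singleton_coeff_zero x none

lemma pointedSeries_singleton_coeff_zero (x : Option ι → A) (i : ι) :
    PowerSeries.coeff 0 (pointedSeries x {i}) = x none + x (some i) := by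
  have h := congrArg PowerSeries.constantCoeff (pointedSeries_rec x {i})
  have hp : ({i} : Finset ι).powerset = {∅, {i}} := by
    ext J
    simp [Finset.subset_singleton_iff]
  have hD (f : PowerSeries A) : PowerSeries.constantCoeff (eulerD A f) = 0 := by
    rw [← PowerSeries.coeff_zero_eq_constantCoeff_apply, coeff_eulerD]
    simp
  have h1 := pointedSeries_empty_coeff_zero x
  have h2 := nptSeries_singleton_coeff_zero (x ∘ some) i
  rw [PowerSeries.coeff_zero_eq_constantCoeff_apply] at h1 h2 ⊢
  rw [hp, Finset.sum_pair (Finset.singleton_ne_empty i).symm, Finset.sdiff_empty,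
    Finset.sdiff_self, nptSeries_empty] at h
  simp only [map_mul, map_add, hD, h1, h2, Finset.card_singleton, Nat.cast_one, map_one,
    Finset.sum_singleton, PowerSeries.constantCoeff_X, PowerSeries.constantCoeff_C,
    map_zero, map_ofNat] at h
  refine intCast_mul_cancel (m := 12) (by norm_num) ?_
  push_cast
  simpa using h

end PointedSeries

/-! ### Expansions of powers of `y + c` -/

section Expansions

lemma binomZ_zero (p : ℤ) : binomZ p 0 = 1 := by simp [binomZ]

lemma binomZ_add_one (p : ℤ) (k : ℕ) :
    binomZ (p + 1) (k + 1) = binomZ p (k + 1) + binomZ p k := by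
  have h1 : ∏ i ∈ range (k + 1), (((p + 1 : ℤ) : ℚ) - i) =
      ((p : ℚ) + 1) * ∏ i ∈ range k, ((p : ℚ) - i) := by
    rw [Finset.prod_range_succ', mul_comm]
    push_cast
    simp
  have h2 : ∏ i ∈ range (k + 1), ((p : ℚ) - i) = (∏ i ∈ range k, ((p : ℚ) - i)) * (p - k) :=
    Finset.prod_range_succ _ _
  have hk : (k.factorial : ℚ) ≠ 0 := by exact_mod_cast k.factorial_ne_zero
  rw [binomZ, binomZ, binomZ, h1, h2, Nat.factorial_succ]
  push_cast
  field_simp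
  ring

lemma binomZ_zero_succ (k : ℕ) : binomZ 0 (k + 1) = 0 := by
  rw [binomZ, Finset.prod_range_succ']
  simp

/-- The variable `y` as a Laurent series in `t = y⁻¹`. -/
def yVar (B : Type*) [CommRing B] : LaurentSeries B := HahnSeries.single (-1 : ℤ) (1 : B)

variable {n : ℕ}

lemma yExpAdd_zero (c : R n) : yExpAdd c 0 = 1 := by
  have : (PowerSeries.mk fun k => MvPolynomial.C (binomZ 0 k) * c ^ k : PowerSeries (R n)) = 1 := by
    ext1 k
    cases k with
    | zero => simp [binomZ_zero]
    | succ k => simp [binomZ_zero_succ, PowerSeries.coeff_one]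
  rw [yExpAdd, this, neg_zero, RingHom.map_one, mul_one]
  rfl

lemma yExpAdd_add_one (c : R n) (m : ℤ) :
    yExpAdd c (m + 1) = yExpAdd c m * (yVar (R n) + HahnSeries.C c) := by
  have e : (PowerSeries.mk fun k => MvPolynomial.C (binomZ (m + 1) k) * c ^ k :
      PowerSeries (R n)) =
      (PowerSeries.mk fun k => MvPolynomial.C (binomZ m k) * c ^ k) *
        (1 + PowerSeries.X * PowerSeries.C c) := by
    ext1 k
    rw [mul_add, mul_one, map_add, ← mul_assoc, PowerSeries.coeff_mul_C]
    cases k with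
    | zero => simp [binomZ_zero]
    | succ k =>
      rw [PowerSeries.coeff_succ_mul_X, PowerSeries.coeff_mk, PowerSeries.coeff_mk,
        PowerSeries.coeff_mk, binomZ_add_one, map_add]
      ring
  have e2 : yVar (R n) + HahnSeries.C c =
      yVar (R n) * HahnSeries.ofPowerSeries ℤ (R n) (1 + PowerSeries.X * PowerSeries.C c) := by
    rw [map_add, map_one, map_mul, HahnSeries.ofPowerSeries_X, HahnSeries.ofPowerSeries_C,
      mul_add, mul_one, ← mul_assoc, yVar, HahnSeries.single_mul_single]
    simp
  rw [e2, yExpAdd, yExpAdd, e, map_mul, yVar, neg_add, ← mul_one (1 : R n),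
    ← HahnSeries.single_mul_single]
  simp only [mul_one]
  ring

lemma yExpAdd_neg_one_mul (c : R n) : yExpAdd c (-1) * (yVar (R n) + HahnSeries.C c) = 1 := by
  rw [← yExpAdd_add_one, neg_add_cancel, yExpAdd_zero]

lemma yExpAdd_sub_one (c : R n) (m : ℤ) :
    yExpAdd c (m - 1) = yExpAdd c m * yExpAdd c (-1) := by
  have h := yExpAdd_add_one c (m - 1)
  rw [sub_add_cancel] at h
  rw [h, mul_assoc, mul_comm _ (yExpAdd c (-1)), yExpAdd_neg_one_mul, mul_one]

lemma yExpAdd_add_two (c : R n) (m : ℤ) :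
    yExpAdd c m = yExpAdd c (m - 2) * (yVar (R n) + HahnSeries.C c) ^ 2 := by
  rw [pow_two, ← mul_assoc, ← yExpAdd_add_one, ← yExpAdd_add_one]
  congr 1
  ring

lemma LExp_true (c : R n) (m : ℤ) : LExp true c m = yExpAdd c m := by
  simp [LExp]

lemma LExp_false (c : R n) (m : ℤ) :
    LExp false c m = (if Even m then 1 else -1) * yExpAdd (-c) m := by
  simp [LExp]

end Expansions

/-! ### Filtration by the degree in `y` -/

section DegreeBound

variable {B : Type*} [CommRing B]

/-- `f` has `y`-degree at most `d`. -/
def YDegLE (d : ℤ) (f : LaurentSeries B) : Prop := ∀ k : ℤ, d < k → f.coeff (-k) = 0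

lemma YDegLE.zero (d : ℤ) : YDegLE d (0 : LaurentSeries B) := fun _ _ => rfl

lemma YDegLE.mono {d e : ℤ} {f : LaurentSeries B} (h : YDegLE d f) (hde : d ≤ e) : YDegLE e f :=
  fun k hk => h k (by omega)

lemma YDegLE.add {d : ℤ} {f h : LaurentSeries B} (hf : YDegLE d f) (hh : YDegLE d h) :
    YDegLE d (f + h) := fun k hk => by
  rw [HahnSeries.coeff_add, hf k hk, hh k hk, add_zero]

lemma YDegLE.sum {ι : Type*} {d : ℤ} {s : Finset ι} {f : ι → LaurentSeries B}
    (h : ∀ i ∈ s, YDegLE d (f i)) : YDegLE d (∑ i ∈ s, f i) :=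
  Finset.sum_induction f (YDegLE d) (fun _ _ => YDegLE.add) (YDegLE.zero d) h

lemma YDegLE.mul {d e : ℤ} {f h : LaurentSeries B} (hf : YDegLE d f) (hh : YDegLE e h) :
    YDegLE (d + e) (f * h) := fun k hk => by
  rw [HahnSeries.coeff_mul]
  refine Finset.sum_eq_zero fun p hp => ?_
  rw [Finset.mem_antidiagonal] at hp
  by_cases h1 : d < -p.1
  · have := hf _ h1
    rw [neg_neg] at this
    rw [this, zero_mul]
  · have := hh (-p.2) (by omega)
    rw [neg_neg] at this
    rw [this, mul_zero]

lemma YDegLE.const (r : B) : YDegLE 0 (HahnSeries.C r : LaurentSeries B) := fun k hk => by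
  rw [HahnSeries.C_apply, HahnSeries.coeff_single_of_ne (by omega)]

lemma YDegLE.var : YDegLE 1 (yVar B) := fun k hk => by
  rw [yVar, HahnSeries.coeff_single_of_ne (by omega)]

lemma YDegLE.of_intCast_mul [Algebra ℚ B] {m : ℤ} (hm : m ≠ 0) {d : ℤ} {f : LaurentSeries B}
    (h : YDegLE d ((m : LaurentSeries B) * f)) : YDegLE d f := fun k hk => by
  have e := h k hk
  rw [← map_intCast HahnSeries.C, HahnSeries.C_mul_eq_smul, HahnSeries.coeff_smul,
    smul_eq_mul] at e
  exact intCast_mul_cancel hm (e.trans (mul_zero _).symm)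

lemma YDegLE.yExpAdd_neg_one {n : ℕ} (c : R n) : YDegLE (-1) (yExpAdd c (-1)) := by
  have h1 : YDegLE (-1) (HahnSeries.single (-(-1) : ℤ) (1 : R n)) := fun k hk => by
    rw [HahnSeries.coeff_single_of_ne (by omega)]
  have h2 (f : PowerSeries (R n)) : YDegLE 0 (HahnSeries.ofPowerSeries ℤ (R n) f) := fun k hk => by
    refine HahnSeries.embDomain_of_notMem_range ?_
    rintro ⟨m, hm⟩
    have : (m : ℤ) = -k := hm
    omega
  exact h1.mul (h2 _)

end DegreeBound

/-! ### Pairings of two families with opposite distinguished points -/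

section Pairing

variable {ι : Type*} [DecidableEq ι] {A : Type*} [CommRing A] [Algebra ℚ A]

/-- The weighted convolution `Σ_{I ⊔ J = U} w(I) P(I) M(J)` of two pointed families. -/
def pairing (u v : Option ι → A) (w : Finset ι → A) (U : Finset ι) : PowerSeries A :=
  ∑ I ∈ U.powerset, PowerSeries.C (w I) * pointedSeries u I * pointedSeries v (U \ I)

lemma pairing_congr {u v : Option ι → A} {w w' : Finset ι → A} {U : Finset ι}
    (h : ∀ I ⊆ U, w I = w' I) : pairing u v w U = pairing u v w' U :=
  Finset.sum_congr rfl fun I hI => by rw [h I (Finset.mem_powerset.1 hI)]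

lemma pairing_rec (u v : Option ι → A) (huv : u ∘ some = v ∘ some) (w : Finset ι → A)
    (U : Finset ι) :
    12 * (eulerD A (pairing u v w U) + (U.card : PowerSeries A) * pairing u v w U) =
      PowerSeries.X * pairing u v (fun I => w I * ((u none + ∑ i ∈ I, u (some i)) ^ 3 +
        (v none + ∑ i ∈ U \ I, v (some i)) ^ 3)) U +
      12 * ∑ L ∈ U.powerset, nptSeries (u ∘ some) L *
        pairing u v (fun I => w (I ∪ L) * (u none + ∑ i ∈ I ∪ L, u (some i)) +
          w I * (v none + ∑ i ∈ U \ I, v (some i))) (U \ L) := by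
  set Y : Finset ι → A := fun I => u none + ∑ i ∈ I, u (some i) with hY
  set Z : Finset ι → A := fun I => v none + ∑ i ∈ I, v (some i) with hZ
  have hP (I : Finset ι) := pointedSeries_rec u I
  have hM (I : Finset ι) := pointedSeries_rec v I
  rw [← huv] at hM
  have hsum1 := sum_powerset_powerset (fun B L J => PowerSeries.C (w (B ∪ L) * Y (B ∪ L)) *
    pointedSeries u B * nptSeries (u ∘ some) L * pointedSeries v J) U
  have hsum2 := sum_powerset_powerset_sdiff (fun I L J => PowerSeries.C (w I * Z (U \ I)) *
    pointedSeries u I * nptSeries (u ∘ some) L * pointedSeries v J) U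
  have hlhs : 12 * (eulerD A (pairing u v w U) + (U.card : PowerSeries A) * pairing u v w U) =
      ∑ I ∈ U.powerset, (PowerSeries.X * (PowerSeries.C (w I * (Y I ^ 3 + Z (U \ I) ^ 3)) *
        pointedSeries u I * pointedSeries v (U \ I)) +
        12 * ∑ B ∈ I.powerset, PowerSeries.C (w (B ∪ (I \ B)) * Y (B ∪ (I \ B))) *
          pointedSeries u B * nptSeries (u ∘ some) (I \ B) * pointedSeries v (U \ I) +
        12 * ∑ L ∈ (U \ I).powerset, PowerSeries.C (w I * Z (U \ I)) *
          pointedSeries u I * nptSeries (u ∘ some) L * pointedSeries v ((U \ I) \ L)) := by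
    simp only [pairing, map_sum, Finset.mul_sum, ← Finset.sum_add_distrib]
    refine Finset.sum_congr rfl fun I hI => ?_
    have hI' := Finset.mem_powerset.1 hI
    have hcard : (U.card : PowerSeries A) = I.card + (U \ I).card := by
      rw [← Finset.card_sdiff_add_card_eq_card hI']
      push_cast
      ring
    have e1 : ∑ B ∈ I.powerset, PowerSeries.C (w (B ∪ (I \ B)) * Y (B ∪ (I \ B))) *
        pointedSeries u B * nptSeries (u ∘ some) (I \ B) * pointedSeries v (U \ I) =
        PowerSeries.C (w I * Y I) * (∑ B ∈ I.powerset, pointedSeries u B *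
          nptSeries (u ∘ some) (I \ B)) * pointedSeries v (U \ I) := by
      rw [Finset.mul_sum, Finset.sum_mul]
      refine Finset.sum_congr rfl fun B hB => ?_
      rw [Finset.union_sdiff_of_subset (Finset.mem_powerset.1 hB)]
      ring
    have e2 : ∑ L ∈ (U \ I).powerset, PowerSeries.C (w I * Z (U \ I)) *
        pointedSeries u I * nptSeries (u ∘ some) L * pointedSeries v ((U \ I) \ L) =
        PowerSeries.C (w I * Z (U \ I)) * pointedSeries u I *
          ∑ B ∈ (U \ I).powerset, pointedSeries v B * nptSeries (u ∘ some) ((U \ I) \ B) := by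
      rw [sum_powerset_sdiff fun B L => pointedSeries v B * nptSeries (u ∘ some) L,
        Finset.mul_sum]
      refine Finset.sum_congr rfl fun B _ => ?_
      ring
    rw [← Finset.mul_sum, ← Finset.mul_sum, e1, e2, mul_assoc (PowerSeries.C (w I)),
      eulerD_C_mul, eulerD_mul, hcard]
    have h1 := hP I
    have h2 := hM (U \ I)
    change _ = PowerSeries.C (Y I ^ 3) * _ + 12 * PowerSeries.C (Y I) * _ at h1
    change _ = PowerSeries.C (Z (U \ I) ^ 3) * _ + 12 * PowerSeries.C (Z (U \ I)) * _ at h2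
    rw [map_pow] at h1 h2
    simp only [map_mul, map_add, map_pow]
    linear_combination PowerSeries.C (w I) * pointedSeries v (U \ I) * h1 +
      PowerSeries.C (w I) * pointedSeries u I * h2
  rw [hlhs, Finset.sum_add_distrib, Finset.sum_add_distrib, ← Finset.mul_sum, ← Finset.mul_sum,
    ← Finset.mul_sum, hsum1, hsum2, add_assoc, ← mul_add, ← Finset.sum_add_distrib]
  congr 2
  refine Finset.sum_congr rfl fun L _ => ?_
  rw [pairing, Finset.mul_sum, ← Finset.sum_add_distrib]
  refine Finset.sum_congr rfl fun I _ => ?_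
  simp only [hY, hZ, map_add, map_mul]
  ring

lemma coeff_pairing_rec (u v : Option ι → A) (huv : u ∘ some = v ∘ some) (w : Finset ι → A)
    (U : Finset ι) (g : ℕ) :
    ((12 * (2 * g + U.card) : ℤ) : A) * PowerSeries.coeff g (pairing u v w U) =
      (if 0 < g then PowerSeries.coeff (g - 1)
        (pairing u v (fun I => w I * ((u none + ∑ i ∈ I, u (some i)) ^ 3 +
          (v none + ∑ i ∈ U \ I, v (some i)) ^ 3)) U) else 0) +
      12 * ∑ L ∈ U.powerset, ∑ p ∈ antidiagonal g,
        PowerSeries.coeff p.1 (nptSeries (u ∘ some) L) * PowerSeries.coeff p.2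
          (pairing u v (fun I => w (I ∪ L) * (u none + ∑ i ∈ I ∪ L, u (some i)) +
            w I * (v none + ∑ i ∈ U \ I, v (some i))) (U \ L)) := by
  have hrec := congrArg (PowerSeries.coeff g) (pairing_rec u v huv w U)
  have hl := coeff_quadRec_lhs (pairing u v w U) (U.card + 1) g
  have hc : (12 * (2 * g + ((U.card + 1 : ℕ) : ℤ) - 1) : ℤ) = 12 * (2 * g + U.card) := by
    push_cast
    ring
  have h12 : (12 : PowerSeries A) = PowerSeries.C 12 := (map_ofNat _ 12).symm
  rw [hc, Nat.cast_add, Nat.cast_one, add_sub_cancel_right, hrec, map_add, coeff_X_mul_eq, h12,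
    PowerSeries.coeff_C_mul, map_sum] at hl
  simp only [PowerSeries.coeff_mul] at hl
  exact hl.symm

lemma pairing_empty_coeff_zero (u v : Option ι → A) (w : Finset ι → A) :
    PowerSeries.coeff 0 (pairing u v w ∅) = w ∅ := by
  have h1 := pointedSeries_empty_coeff_zero u
  have h2 := pointedSeries_empty_coeff_zero v
  rw [PowerSeries.coeff_zero_eq_constantCoeff_apply] at h1 h2
  rw [pairing, Finset.powerset_empty, Finset.sum_singleton, Finset.sdiff_self,
    PowerSeries.coeff_zero_eq_constantCoeff_apply, map_mul, map_mul, h1, h2,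
    PowerSeries.constantCoeff_C, mul_one, mul_one]

end Pairing

/-! ### Weights depending on a shift of `y` -/

section ShiftWeight

variable {B : Type*} [CommRing B]

/-- `w c` is obtained by substituting `y + c` for `y` in a rational function of `y`, of degree
at most `d`, whose poles are at points of `B`. -/
inductive ShiftWeight : ℤ → (B → LaurentSeries B) → Prop
  | zero (d : ℤ) : ShiftWeight d fun _ => 0
  | const (r : B) : ShiftWeight 0 fun _ => HahnSeries.C r
  | var (s : B) : ShiftWeight 1 fun c => yVar B + HahnSeries.C (c + s)
  | inv (s : B) {w : B → LaurentSeries B}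
      (hw : ∀ c, w c * (yVar B + HahnSeries.C (c + s)) = 1) (hd : ∀ c, YDegLE (-1) (w c)) :
      ShiftWeight (-1) w
  | add {d : ℤ} {w w' : B → LaurentSeries B} : ShiftWeight d w → ShiftWeight d w' →
      ShiftWeight d fun c => w c + w' c
  | mul {d e : ℤ} {w w' : B → LaurentSeries B} : ShiftWeight d w → ShiftWeight e w' →
      ShiftWeight (d + e) fun c => w c * w' c
  | mono {d e : ℤ} {w : B → LaurentSeries B} : ShiftWeight d w → d ≤ e → ShiftWeight e w

namespace ShiftWeight

lemma yDegLE {d : ℤ} {w : B → LaurentSeries B} (h : ShiftWeight d w) (c : B) : YDegLE d (w c) := by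
  induction h with
  | zero d => exact YDegLE.zero d
  | const r => exact YDegLE.const r
  | var s => exact YDegLE.var.add ((YDegLE.const _).mono (by norm_num))
  | inv s _ hd => exact hd c
  | add _ _ h1 h2 => exact h1.add h2
  | mul _ _ h1 h2 => exact h1.mul h2
  | mono _ hde h => exact h.mono hde

lemma shift {d : ℤ} {w : B → LaurentSeries B} (h : ShiftWeight d w) (s : B) :
    ShiftWeight d fun c => w (c + s) := by
  induction h with
  | zero d => exact zero d
  | const r => exact const r
  | var t => simpa only [add_assoc] using var (s + t)
  | inv t hw hd => exact inv (s + t) (fun c => by rw [← hw (c + s), add_assoc]) fun c => hd _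
  | add _ _ h1 h2 => exact h1.add h2
  | mul _ _ h1 h2 => exact h1.mul h2
  | mono _ hde h => exact h.mono hde

lemma congr {d e : ℤ} {w w' : B → LaurentSeries B} (h : ShiftWeight d w) (hde : d ≤ e)
    (hw : ∀ c, w' c = w c) : ShiftWeight e w' := by
  rw [funext hw]
  exact h.mono hde

lemma sub_shift {d : ℤ} {w : B → LaurentSeries B} (h : ShiftWeight d w) (s : B) :
    ShiftWeight (d - 1) fun c => w (c + s) - w c := by
  induction h with
  | zero d => exact (zero (d - 1)).congr le_rfl fun c => sub_self _
  | const r => exact (zero _).congr le_rfl fun c => sub_self _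
  | var t =>
    refine (const s).congr (by norm_num) fun c => ?_
    simp only [map_add]
    ring
  | @inv t w hw hd =>
    refine ((const (-s)).mul (((inv t hw hd).shift s).mul (inv t hw hd))).congr
      (by norm_num) fun c => ?_
    have h1 := hw (c + s)
    have h2 := hw c
    simp only [map_add, map_neg] at h1 h2 ⊢
    linear_combination w c * h1 - w (c + s) * h2
  | add _ _ h1 h2 =>
    refine (h1.add h2).congr le_rfl fun c => ?_
    ring
  | @mul d e w w' hw hw' h1 h2 =>
    refine (((h1.mul (hw'.shift s)).mono (e := d + e - 1) (by omega)).add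
      ((hw.mul h2).mono (e := d + e - 1) (by omega))).congr le_rfl fun c => ?_
    ring
  | mono _ hde h => exact h.mono (by omega)

end ShiftWeight

lemma ShiftWeight.yExpAdd_shift {n : ℕ} (s : R n) (m : ℤ) : ShiftWeight m fun c => yExpAdd (c + s) m := by
  induction m using Int.induction_on with
  | zero =>
    refine (ShiftWeight.const (1 : R n)).congr le_rfl fun c => ?_
    rw [yExpAdd_zero]
    rfl
  | succ m ih => exact (ih.mul (ShiftWeight.var s)).congr le_rfl fun c => yExpAdd_add_one _ _
  | pred m ih => exact (ih.mul (ShiftWeight.inv s (fun c => yExpAdd_neg_one_mul _)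
      fun c => YDegLE.yExpAdd_neg_one _)).congr le_rfl fun c => yExpAdd_sub_one _ _

end ShiftWeight

/-! ### The degree in `y` of the pairings -/

section PairingDegree

variable {ι : Type*} {B : Type*} [CommRing B]

/-- The arguments `±y` and `x`. -/
def signedVars (x : ι → B) (σ : Bool) : Option ι → LaurentSeries B :=
  fun o => o.elim (if σ then yVar B else -yVar B) fun i => HahnSeries.C (x i)

lemma signedVars_true_sum (x : ι → B) (I : Finset ι) :
    signedVars x true none + ∑ i ∈ I, signedVars x true (some i) =
      yVar B + HahnSeries.C (∑ i ∈ I, x i) := by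
  rw [map_sum]
  rfl

lemma signedVars_false_sum (x : ι → B) (I : Finset ι) :
    signedVars x false none + ∑ i ∈ I, signedVars x false (some i) =
      -yVar B + HahnSeries.C (∑ i ∈ I, x i) := by
  rw [map_sum]
  rfl

lemma signedVars_comp_some (x : ι → B) (σ : Bool) :
    signedVars x σ ∘ some = (HahnSeries.C : B →+* LaurentSeries B) ∘ x := rfl

variable [DecidableEq ι]

lemma YDegLE.coeff_nptSeries_const [Algebra ℚ B] (x : ι → B) (I : Finset ι) (σ : Bool) (g : ℕ) :
    YDegLE 0 (PowerSeries.coeff g (nptSeries (signedVars x σ ∘ some) I)) := by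
  rw [signedVars_comp_some, ← map_nptSeries, PowerSeries.coeff_map]
  exact YDegLE.const _

lemma YDegLE.twelve_mul {d : ℤ} {f : LaurentSeries B} (h : YDegLE d f) : YDegLE d (12 * f) := by
  have h12 : (12 : LaurentSeries B) = HahnSeries.C (12 : B) := (map_ofNat _ 12).symm
  rw [h12]
  simpa using (YDegLE.const 12).mul h

lemma ShiftWeight.sum_cubes {d : ℤ} {w : B → LaurentSeries B} (h : ShiftWeight d w) (s : B) :
    ShiftWeight (d + 2) fun c =>
      w c * ((yVar B + HahnSeries.C c) ^ 3 + (-yVar B + HahnSeries.C (s - c)) ^ 3) := by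
  have h1 : ShiftWeight 1 fun c : B => yVar B + HahnSeries.C (c + 0) := ShiftWeight.var 0
  refine (h.mul ((((ShiftWeight.const (s ^ 3)).mono (e := 2) (by norm_num)).add
    (((ShiftWeight.const (-3 * s ^ 2)).mul h1).mono (e := 2) (by norm_num))).add
    (((ShiftWeight.const (3 * s)).mul (h1.mul h1)).mono (e := 2) (by norm_num)))).congr
    le_rfl fun c => ?_
  have h3 : HahnSeries.C (3 : B) = (3 : LaurentSeries B) := map_ofNat _ 3
  simp only [map_mul, map_pow, map_neg, map_sub, h3, add_zero]
  ring

lemma ShiftWeight.shift_mul_sub {d : ℤ} {w : B → LaurentSeries B} (h : ShiftWeight d w) (s t : B) :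
    ShiftWeight d fun c => w (c + t) * (yVar B + HahnSeries.C (c + t)) +
      w c * (-yVar B + HahnSeries.C (s - c)) := by
  have h1 := (h.mul (ShiftWeight.var 0)).sub_shift t
  refine ((h1.mono (e := d) (by omega)).add
    ((h.mul (ShiftWeight.const s)).mono (e := d) (by omega))).congr le_rfl fun c => ?_
  simp only [map_sub, add_zero]
  ring

lemma YDegLE.coeff_pairing [Algebra ℚ B] (x : ι → B) (m g : ℕ) (U : Finset ι) (hm : g + U.card = m) {d : ℤ}
    {w : B → LaurentSeries B} (hw : ShiftWeight d w) :
    YDegLE (2 * g + d) (PowerSeries.coeff g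
      (pairing (signedVars x true) (signedVars x false) (fun I => w (∑ i ∈ I, x i)) U)) := by
  induction m using Nat.strong_induction_on generalizing g U d w with
  | _ m ih =>
  rcases Nat.eq_zero_or_pos m with h0 | hpos
  · obtain ⟨rfl, hU⟩ : g = 0 ∧ U.card = 0 := by omega
    rw [Finset.card_eq_zero] at hU
    subst hU
    rw [pairing_empty_coeff_zero, Finset.sum_empty]
    simpa using hw.yDegLE 0
  · have hm0 : (12 * (2 * g + U.card) : ℤ) ≠ 0 := by omega
    refine YDegLE.of_intCast_mul hm0 ?_
    rw [coeff_pairing_rec (signedVars x true) (signedVars x false) rfl]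
    have hsum (I J : Finset ι) (hIJ : I ⊆ J) :
        ∑ i ∈ J \ I, x i = ∑ i ∈ J, x i - ∑ i ∈ I, x i :=
      eq_sub_of_add_eq (Finset.sum_sdiff hIJ)
    simp only [signedVars_true_sum, signedVars_false_sum]
    refine YDegLE.add ?_ ?_
    · split_ifs with hg
      · rw [pairing_congr (w' := fun I => (fun c => w c * ((yVar B + HahnSeries.C c) ^ 3 +
          (-yVar B + HahnSeries.C (∑ i ∈ U, x i - c)) ^ 3)) (∑ i ∈ I, x i))
          fun I hI => by rw [hsum I U hI]]
        refine (ih (g - 1 + U.card) (by omega) (g - 1) U rfl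
          (hw.sum_cubes (∑ i ∈ U, x i))).mono (by omega)
      · exact YDegLE.zero _
    · refine YDegLE.twelve_mul (YDegLE.sum fun L hL => YDegLE.sum fun p hp => ?_)
      rw [Finset.mem_powerset] at hL
      rcases L.eq_empty_or_nonempty with rfl | hne
      · rw [nptSeries_empty, map_zero, zero_mul]
        exact YDegLE.zero _
      rw [Finset.HasAntidiagonal.mem_antidiagonal] at hp
      have hcard := Finset.card_sdiff_add_card_eq_card hL
      have hLpos := hne.card_pos
      rw [pairing_congr (w' := fun I => (fun c => w (c + ∑ i ∈ L, x i) *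
          (yVar B + HahnSeries.C (c + ∑ i ∈ L, x i)) +
          w c * (-yVar B + HahnSeries.C (∑ i ∈ U, x i - c))) (∑ i ∈ I, x i))]
      · refine ((YDegLE.coeff_nptSeries_const x L true p.1).mul
          (ih (p.2 + (U \ L).card) (by omega) p.2 (U \ L) rfl
            (hw.shift_mul_sub (∑ i ∈ U, x i) (∑ i ∈ L, x i)))).mono (by omega)
      · intro I hI
        rw [Finset.subset_sdiff] at hI
        rw [hsum I U hI.1, Finset.sum_union hI.2]

end PairingDegree
/-! ### The expansions of the `n`-point functions -/

section LaurentArithmetic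

variable {B : Type*} [CommRing B]

lemma yVar_sq_mul_single_two : yVar B ^ 2 * HahnSeries.single (2 : ℤ) (1 : B) = 1 := by
  rw [yVar, HahnSeries.single_pow, HahnSeries.single_mul_single]
  simp

lemma sq_mul_single_two (σ : Bool) :
    (if σ then yVar B else -yVar B) ^ 2 * HahnSeries.single (2 : ℤ) (1 : B) = 1 := by
  cases σ <;> simp [yVar_sq_mul_single_two]

lemma sq_mul_of_mul_eq_one {c : B} {z : LaurentSeries B}
    (h : z * (yVar B + HahnSeries.C c) = 1) :
    (yVar B + HahnSeries.C c) ^ 2 * z = yVar B + HahnSeries.C c := by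
  linear_combination (yVar B + HahnSeries.C c) * h

lemma sq_mul_neg_of_mul_eq_one {c : B} {z : LaurentSeries B}
    (h : z * (yVar B + HahnSeries.C (-c)) = 1) :
    (-yVar B + HahnSeries.C c) ^ 2 * (-1 * z) = -yVar B + HahnSeries.C c := by
  rw [map_neg] at h
  linear_combination (-yVar B + HahnSeries.C c) * h

lemma mul_sq_rearrange (c c' : B) (s p q F H : LaurentSeries B) :
    p * (yVar B + HahnSeries.C c) ^ 2 * (s * (q * (yVar B + HahnSeries.C (-c')) ^ 2)) * F * H =
      s * (p * q) *
        (((yVar B + HahnSeries.C c) ^ 2 * F) * ((-yVar B + HahnSeries.C c') ^ 2 * H)) := by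
  rw [map_neg]
  ring

lemma C_ite_neg_one (p : Prop) [Decidable p] :
    (HahnSeries.C (if p then 1 else -1 : B) : LaurentSeries B) = if p then 1 else -1 := by
  split_ifs <;> simp

end LaurentArithmetic

section Main

variable {n : ℕ}

lemma yLau_eq (n : ℕ) (σ : Bool) : yLau n σ = if σ then yVar (R n) else -yVar (R n) := by
  cases σ
  · exact neg_one_mul (yVar (R n))
  · exact one_mul (yVar (R n))

lemma sq_mul_FExp (σ : Bool) (g : ℕ) (I : Finset (Fin n)) :
    (yLau n σ + HahnSeries.C (∑ i ∈ I, X i)) ^ 2 * FExp σ g I =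
      PowerSeries.coeff g (pointedSeries (signedVars (X : Fin n → R n) σ) I) := by
  unfold FExp
  split_ifs with h0 h1
  · obtain ⟨rfl, hI⟩ := h0
    rw [Finset.card_eq_zero] at hI
    subst hI
    rw [pointedSeries_empty_coeff_zero, Finset.sum_empty, map_zero, add_zero, yLau_eq]
    exact sq_mul_single_two σ
  · obtain ⟨rfl, hI⟩ := h1
    obtain ⟨i, rfl⟩ := Finset.card_eq_one.1 hI
    rw [pointedSeries_singleton_coeff_zero, Finset.sum_singleton, yLau_eq]
    cases σ
    · rw [LExp_false, if_neg (by decide)]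
      exact sq_mul_neg_of_mul_eq_one (yExpAdd_neg_one_mul (-X i : R n))
    · rw [LExp_true]
      exact sq_mul_of_mul_eq_one (yExpAdd_neg_one_mul (X i : R n))
  · set v : Fin (I.card + 1) → Lau n := Fin.cons (yLau n σ)
      (fun i : Fin I.card => HahnSeries.C (X ((I.orderIsoOfFin rfl) i : Fin n))) with hv
    set φ := MvPolynomial.eval₂Hom ((HahnSeries.C : R n →+* Lau n).comp (algebraMap ℚ (R n))) v
      with hφ
    let e : Fin (I.card + 1) ↪ Option (Fin n) :=
      ⟨Fin.cons none (some ∘ enumEmb I), Fin.cons_injective_iff.2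
        ⟨by simp, (Option.some_injective _).comp (enumEmb I).injective⟩⟩
    have he : univ.map e = pointedSet I := by
      apply Finset.coe_injective
      rw [pointedSet, Finset.coe_map, Finset.coe_univ, Set.image_univ, Finset.coe_insert,
        Finset.coe_map]
      conv_rhs => rw [← map_enumEmb I]
      rw [Finset.coe_map, Finset.coe_univ, Set.image_univ, ← Set.range_comp]
      exact Fin.range_cons _ _
    have hve : φ ∘ X = signedVars (X : Fin n → R n) σ ∘ e := by
      funext i
      refine Fin.cases ?_ (fun i => ?_) i
      · exact (MvPolynomial.eval₂_X _ _ _).trans (yLau_eq n σ)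
      · exact MvPolynomial.eval₂_X _ _ _
    have h := congrArg φ (sq_mul_polyOf_Fnpt (I.card + 1) g (by omega) (by omega))
    rw [← PowerSeries.coeff_map, map_nptSeries, hve, ← nptSeries_comp_embedding, he, map_mul,
      map_pow, map_sum] at h
    rw [pointedSeries, ← h]
    have hs : ∑ i, φ (X i) = yLau n σ + HahnSeries.C (∑ i ∈ I, X i) := by
      have h2 : ∑ i, φ (X i) = ∑ i ∈ univ.map e, signedVars (X : Fin n → R n) σ i := by
        rw [Finset.sum_map]
        exact Finset.sum_congr rfl fun i _ => congrFun hve i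
      rw [h2, he, sum_pointedSet, map_sum, yLau_eq]
      rfl
    rw [hs]
    rfl

lemma LL_eq_coeff_pairing (g n : ℕ) (a b : ℤ) :
    LL g n a b = PowerSeries.coeff g (pairing (signedVars (X : Fin n → R n) true) (signedVars (X : Fin n → R n) false)
      (fun I => (fun c : R n => HahnSeries.C (if Even b then 1 else -1) *
        (yExpAdd (c + 0) (a - 2) * yExpAdd (c + -∑ i, X i) (b - 2))) (∑ i ∈ I, X i)) univ) := by
  rw [LL, Finset.sum_comm, pairing, Finset.powerset_univ, map_sum]
  refine Finset.sum_congr rfl fun I _ => ?_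
  rw [mul_assoc, PowerSeries.coeff_C_mul, PowerSeries.coeff_mul,
    Finset.Nat.sum_antidiagonal_eq_sum_range_succ_mk, Finset.mul_sum]
  refine Finset.sum_congr rfl fun p _ => ?_
  have hS : (∑ i ∈ I, X i + -∑ i, X i : R n) = -∑ i ∈ Iᶜ, X i := by
    rw [← Finset.sum_add_sum_compl I]
    ring
  have h1 := sq_mul_FExp true p I
  have h2 := sq_mul_FExp false (g - p) Iᶜ
  rw [yLau_eq] at h1 h2
  dsimp only
  rw [← Finset.compl_eq_univ_sdiff, ← h1, ← h2, hS, add_zero, LExp_true,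
    LExp_false, yExpAdd_add_two _ a, yExpAdd_add_two _ b, C_ite_neg_one]
  exact mul_sq_rearrange _ _ _ _ _ _ _

end Main

/-- For `g ≥ 0`, `n ≥ 1`, `a b : ℤ` and `k ≥ 2g−3+a+b`, the coefficient of
`y^k Π x_j^{d_j}` in `L_g^{a,b}(y,x_1,…,x_n)` vanishes for all `d_j ≥ 0`. -/
theorem Lab_high_coeff_vanish (g n : ℕ) (hn : 1 ≤ n) (a b : ℤ) (k : ℤ)
    (hk : 2*(g : ℤ) - 3 + a + b ≤ k) (d : Fin n → ℕ) :
    coeffL (LL g n a b) k d = 0 := by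
  have hw := (ShiftWeight.const (if Even b then 1 else -1 : R n)).mul
    ((ShiftWeight.yExpAdd_shift (0 : R n) (a - 2)).mul
      (ShiftWeight.yExpAdd_shift (-∑ i, X i : R n) (b - 2)))
  have h := YDegLE.coeff_pairing (X : Fin n → R n) _ g univ rfl hw k (by omega)
  rw [coeffL, LL_eq_coeff_pairing, h, MvPolynomial.coeff_zero]

end
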